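/- Let m be a squarefree nonzero integer. Then uniformly for real X > 1 and integers q ≥ 1 with gcd(m,q) = 1, one has 𝒜[m](X,q) = φ(q)·(C(q)·X/q)² + (C/2)·Γ_an(m)·Γ_ar(m)·∏_{p∣q}(1+2p^{-1})^{-1}·X^{1/2}q^{1/2} + O_m(d(q)·X^{1/3}q^{2/3}), where φ is Euler's totient, d(q) is the number of divisors of q, and the implied constant depends at most on m. -/

import Mathlib

open scoped BigOperators

/-- The singular constant `C(r) = (6/π²)·∏_{p∣r}(1−p^{-2})^{-1}`. -/
noncomputable def Cq (r : ℕ) : ℝ :=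
  (6 / Real.pi ^ 2) * ∏ p ∈ r.primeFactors, (1 - ((p : ℝ))⁻¹ ^ 2)⁻¹

/-- The constant `C = (ζ(3/2)/π)·∏_p (p³−3p+2)/p³`. -/
noncomputable def Cmain : ℝ :=
  ((riemannZeta (3 / 2)).re / Real.pi) *
    ∏' p : Nat.Primes, ((((p : ℕ) : ℝ) ^ 3 - 3 * ((p : ℕ) : ℝ) + 2) / ((p : ℕ) : ℝ) ^ 3)

/-- The analytic factor `Γ_an(m)`. -/
noncomputable def GammaAn (m : ℤ) : ℝ :=
  if 0 < m then (Real.sqrt m + 1 - Real.sqrt ((m : ℝ) - 1)) / m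
  else (Real.sqrt (1 - (m : ℝ)) - Real.sqrt (-(m : ℝ)) - 1) / (-(m : ℝ))

/-- The arithmetic factor `Γ_ar(m)` for squarefree `m`. -/
noncomputable def GammaArSF (m : ℤ) : ℝ :=
  ∏ p ∈ m.natAbs.primeFactors,
    (1 + ((p : ℝ) + (p : ℝ) ^ ((1 : ℝ)/2) + 1) /
      ((p : ℝ) ^ ((3 : ℝ)/2) + (p : ℝ) ^ ((1 : ℝ)/2) + 1))⁻¹

/-- The multiplicative function `κ` with `κ(p) = (p²−p−1)/(p²−1)`,
`κ(p²) = (p²−p)/(p²−1)` and `κ(p^α) = 0` for `α ≥ 3`. -/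
noncomputable def kappa (n : ℕ) : ℝ :=
  ∏ p ∈ n.primeFactors,
    (if n.factorization p = 1 then ((p : ℝ) ^ 2 - p - 1) / ((p : ℝ) ^ 2 - 1)
     else if n.factorization p = 2 then ((p : ℝ) ^ 2 - p) / ((p : ℝ) ^ 2 - 1) else 0)

/-- The density `f_q(ℓ,m)`; for `ℓ = 0` the last product runs over all primes
not dividing `mq`. -/
noncomputable def fq (q : ℕ) (m ℓ : ℤ) : ℝ :=
  (∏' p : Nat.Primes, (1 - 2 / ((p : ℕ) : ℝ) ^ 2)) *
  (∏ p ∈ m.natAbs.primeFactors, (((p : ℝ) ^ 2 - 1) / ((p : ℝ) ^ 2 - 2))) *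
  (∏ p ∈ q.primeFactors, (((p : ℝ) ^ 2 - p) / ((p : ℝ) ^ 2 - 2))) *
  kappa (Int.gcd ℓ (m ^ 2)) *
  (if ℓ = 0 then
    ∏' p : Nat.Primes,
      (if ((p : ℕ) : ℤ) ∣ m * q then 1
       else ((((p : ℕ) : ℝ)) ^ 2 - 1) / ((((p : ℕ) : ℝ)) ^ 2 - 2))
   else
    ∏ p ∈ ℓ.natAbs.primeFactors.filter
        (fun p : ℕ => ((p : ℤ)) ^ 2 ∣ ℓ ∧ ¬ ((p : ℤ)) ∣ m * q),
      (((p : ℝ) ^ 2 - 1) / ((p : ℝ) ^ 2 - 2)))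

/-- Length of the interval `I(ℓ) = {t ∈ (0,X) : mt + ℓq ∈ (0,X)}`. -/
noncomputable def Ilen (X : ℝ) (m : ℤ) (q : ℕ) (ℓ : ℤ) : ℝ :=
  (MeasureTheory.volume {t : ℝ | 0 < t ∧ t < X ∧
    0 < (m : ℝ) * t + (ℓ : ℝ) * q ∧ (m : ℝ) * t + (ℓ : ℝ) * q < X}).toReal

/-- `𝒜[m](X,q) = Σ_{ℓ ∈ ℤ} f_q(ℓ,m)·|I(ℓ)|`. -/
noncomputable def Acal (m : ℤ) (X : ℝ) (q : ℕ) : ℝ :=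
  ∑' ℓ : ℤ, fq q m ℓ * Ilen X m q ℓ


theorem aux_norm_exp (w : ℂ) (hw : 0 ≤ w.re) : ‖1 - Complex.exp (-w)‖ ≤ 2 ∧ ‖1 - Complex.exp (-w)‖ ≤ 2 * ‖w‖ := by
  have h1 : ‖1 - Complex.exp (-w)‖ ≤ 2 := by
    have h2 : ‖Complex.exp (-w)‖ ≤ 1 := by
      rw [Complex.norm_exp]; simpa using hw
    have := norm_sub_le (1:ℂ) (Complex.exp (-w))
    rw [norm_one] at this
    linarith
  refine ⟨h1, ?_⟩
  rcases le_or_gt ‖w‖ 1 with h | h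
  · have := Complex.norm_exp_sub_one_le (x := -w) (by simpa using h)
    rw [norm_sub_rev]; simpa using this
  · linarith

theorem aux_fres_bound (b : ℂ) (hb : 0 ≤ b.re) (s : ℝ) (hs : 0 < s) :
    ‖(1 - Complex.exp (-b * (s:ℂ)^2)) / (s:ℂ)^2‖ ≤ (2 * ‖b‖ + 2) * (1 + s^2)⁻¹ := by
  have hw : 0 ≤ (b * (s:ℂ)^2).re := by
    have : (b * (s:ℂ)^2).re = b.re * s^2 := by
      rw [← Complex.ofReal_pow, Complex.re_mul_ofReal]
    rw [this]; positivity
  obtain ⟨h1, h2⟩ := aux_norm_exp _ hw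
  rw [← neg_mul] at h1 h2
  have hn : ‖(s:ℂ)^2‖ = s^2 := by simp
  rw [norm_mul, hn] at h2
  rw [norm_div, hn, ← div_eq_mul_inv, div_le_div_iff₀ (by positivity) (by positivity)]
  nlinarith [sq_nonneg s]

theorem aux_fres_int (b : ℂ) (hb : 0 ≤ b.re) :
    MeasureTheory.IntegrableOn (fun s : ℝ => (1 - Complex.exp (-b * (s:ℂ)^2)) / (s:ℂ)^2) (Set.Ioi 0) := by
  refine MeasureTheory.Integrable.mono' (g := fun s : ℝ => (2 * ‖b‖ + 2) * (1 + s^2)⁻¹)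
    ((integrable_inv_one_add_sq.const_mul _).integrableOn) ?_ ?_
  · apply Measurable.aestronglyMeasurable
    fun_prop
  · refine (MeasureTheory.ae_restrict_iff' measurableSet_Ioi).2 (Filter.Eventually.of_forall fun s hs => ?_)
    exact aux_fres_bound b hb s hs

theorem aux_fres_pos (b : ℂ) (hb : 0 < b.re) :
    ∫ s in Set.Ioi (0:ℝ), (1 - Complex.exp (-b * (s:ℂ)^2)) / (s:ℂ)^2 = b * (Real.pi / b) ^ ((1:ℂ)/2) := by
  have hg : MeasureTheory.IntegrableOn (fun s : ℝ => 2 * b * Complex.exp (-b * (s:ℂ)^2)) (Set.Ioi 0) :=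
    ((integrable_cexp_neg_mul_sq hb).const_mul _).integrableOn
  have hf := aux_fres_int b hb.le
  have hnb : ∀ s : ℝ, 0 ≤ s → ‖-(1 - Complex.exp (-b * (s:ℂ)^2)) / (s:ℂ)‖ ≤ 2 * ‖b‖ * s ∧
      ‖-(1 - Complex.exp (-b * (s:ℂ)^2)) / (s:ℂ)‖ ≤ 2 * s⁻¹ := by
    intro s hs
    rcases hs.eq_or_lt with h | h
    · subst h; simp
    have hw : 0 ≤ (b * (s:ℂ)^2).re := by
      have : (b * (s:ℂ)^2).re = b.re * s^2 := by
        rw [← Complex.ofReal_pow, Complex.re_mul_ofReal]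
      rw [this]; positivity
    obtain ⟨h1, h2⟩ := aux_norm_exp _ hw
    rw [← neg_mul] at h1 h2
    have hn : ‖(s:ℂ)^2‖ = s^2 := by simp
    have hn' : ‖(s:ℂ)‖ = s := by simp [abs_of_pos h]
    rw [norm_mul, hn] at h2
    rw [norm_div, norm_neg, hn']
    constructor
    · rw [div_le_iff₀ h]; nlinarith
    · rw [← div_eq_mul_inv]; gcongr
  have key := MeasureTheory.integral_Ioi_of_hasDerivAt_of_tendsto
    (f := fun s : ℝ => -(1 - Complex.exp (-b * (s:ℂ)^2)) / (s:ℂ))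
    (f' := fun s : ℝ => (1 - Complex.exp (-b * (s:ℂ)^2)) / (s:ℂ)^2 - 2 * b * Complex.exp (-b * (s:ℂ)^2))
    (a := 0) (m := 0) ?_ ?_ (hf.sub hg) ?_
  · rw [MeasureTheory.integral_sub hf hg, MeasureTheory.integral_const_mul,
      integral_gaussian_complex_Ioi hb] at key
    simp only [Complex.ofReal_zero, div_zero, sub_zero] at key
    rw [sub_eq_zero] at key
    rw [key]; ring
  · rw [Metric.continuousWithinAt_iff]
    intro ε hε
    refine ⟨ε / (2 * ‖b‖ + 1), by positivity, fun {s} hs hd => ?_⟩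
    simp only [Complex.ofReal_zero, div_zero, dist_zero_right]
    have hs0 : 0 ≤ s := hs
    rw [dist_zero_right, Real.norm_of_nonneg hs0, lt_div_iff₀ (by positivity)] at hd
    have := (hnb s hs0).1
    nlinarith
  · intro s hs
    have hs0 : (s:ℂ) ≠ 0 := by exact_mod_cast (ne_of_gt hs)
    have h1 : HasDerivAt (fun s : ℝ => (s:ℂ)) 1 s := Complex.ofRealCLM.hasDerivAt
    have h2 := ((h1.pow 2).const_mul (-b)).cexp
    have h3 := ((h2.const_sub 1).neg).div h1 hs0
    refine h3.congr_deriv ?_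
    simp
    field_simp
    ring
  · rw [tendsto_zero_iff_norm_tendsto_zero]
    refine squeeze_zero' (Filter.Eventually.of_forall fun _ => norm_nonneg _) ?_
      (by simpa using tendsto_inv_atTop_zero.const_mul (2:ℝ))
    filter_upwards [Filter.eventually_ge_atTop 0] with s hs
    exact (hnb s hs).2

theorem aux_fres (a : ℝ) (ha : 0 < a) :
    ∫ s in Set.Ioi (0:ℝ), (1 - Real.cos (a * s^2)) / s^2 = Real.sqrt (Real.pi * a / 2) := by
  have hI : ∫ s in Set.Ioi (0:ℝ), (1 - Complex.exp (-(a * Complex.I) * (s:ℂ)^2)) / (s:ℂ)^2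
      = (a * Complex.I) * (Real.pi / (a * Complex.I)) ^ ((1:ℂ)/2) := by
    have hne : (a * Complex.I : ℂ) ≠ 0 := by
      simp [ha.ne']
    let b : ℕ → ℂ := fun n => (((1 / ((n:ℝ)+1) : ℝ)) : ℂ) + a * Complex.I
    have hbre : ∀ n, (b n).re = 1 / ((n:ℝ)+1) := by
      intro n
      simp only [b, Complex.add_re, Complex.ofReal_re]
      simp
    have hbl : Filter.Tendsto b Filter.atTop (nhds (a * Complex.I)) := by
      have h1 : Filter.Tendsto (fun n : ℕ => ((1 / ((n:ℝ)+1) : ℝ) : ℂ)) Filter.atTop (nhds ((0:ℝ):ℂ)) :=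
        (Complex.continuous_ofReal.tendsto _).comp tendsto_one_div_add_atTop_nhds_zero_nat
      have := h1.add_const (a * Complex.I)
      simpa [b] using this
    have hbn : ∀ n, ‖b n‖ ≤ 1 + a := by
      intro n
      refine (norm_add_le _ _).trans ?_
      rw [Complex.norm_real, Real.norm_of_nonneg (by positivity)]
      have : 1 / ((n:ℝ)+1) ≤ 1 := by
        rw [div_le_one (by positivity)]; linarith [Nat.cast_nonneg (α := ℝ) n]
      have h3 : ‖(a * Complex.I : ℂ)‖ = a := by simp [abs_of_pos ha]
      linarith
    have l1 := MeasureTheory.tendsto_integral_of_dominated_convergence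
      (μ := MeasureTheory.volume.restrict (Set.Ioi (0:ℝ)))
      (F := fun n (s:ℝ) => (1 - Complex.exp (-(b n) * (s:ℂ)^2)) / (s:ℂ)^2)
      (f := fun s : ℝ => (1 - Complex.exp (-(a * Complex.I) * (s:ℂ)^2)) / (s:ℂ)^2)
      (fun s => (2 * (1 + a) + 2) * (1 + s^2)⁻¹)
      (fun n => (aux_fres_int (b n) (by rw [hbre]; positivity)).1)
      ((integrable_inv_one_add_sq.const_mul _).integrableOn)
      (fun n => (MeasureTheory.ae_restrict_iff' measurableSet_Ioi).2 (Filter.Eventually.of_forall fun s hs => by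
        refine (aux_fres_bound (b n) (by rw [hbre]; positivity) s hs).trans ?_
        gcongr
        exact hbn n))
      (Filter.Eventually.of_forall fun s => by
        have hc : Continuous (fun z : ℂ => (1 - Complex.exp (-z * (s:ℂ)^2)) / (s:ℂ)^2) := by
          fun_prop
        exact (hc.tendsto _).comp hbl)
    have l2 : Filter.Tendsto (fun n => b n * (Real.pi / b n) ^ ((1:ℂ)/2)) Filter.atTop
        (nhds ((a * Complex.I) * (Real.pi / (a * Complex.I)) ^ ((1:ℂ)/2))) := by
      refine hbl.mul ?_
      have hd : Filter.Tendsto (fun n => (Real.pi : ℂ) / b n) Filter.atTop (nhds (Real.pi / (a * Complex.I))) :=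
        tendsto_const_nhds.div hbl hne
      refine (continuousAt_cpow_const ?_).tendsto.comp hd
      right
      rw [Complex.div_im]
      simp [ha.ne', Real.pi_ne_zero]
    refine tendsto_nhds_unique l1 (l2.congr fun n => ?_)
    rw [aux_fres_pos (b n) (by rw [hbre]; positivity)]
  have hint := aux_fres_int (a * Complex.I) (by simp)
  have h2 : ∀ s : ℝ, ((1 - Complex.exp (-(a * Complex.I) * (s:ℂ)^2)) / (s:ℂ)^2).re
      = (1 - Real.cos (a * s^2)) / s^2 := by
    intro s
    have : -(a * Complex.I) * (s:ℂ)^2 = ((-(a * s^2) : ℝ) : ℂ) * Complex.I := by push_cast; ring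
    rw [this, ← Complex.ofReal_pow, Complex.div_ofReal_re, Complex.sub_re, Complex.exp_ofReal_mul_I_re,
      Real.cos_neg, Complex.one_re]
  have h3 := integral_re hint
  simp only [RCLike.re_eq_complex_re] at h3
  simp_rw [h2] at h3
  rw [h3, hI]
  have h4 : (Real.pi / (a * Complex.I) : ℂ) = ((Real.pi / a : ℝ) : ℂ) * (-Complex.I) := by
    push_cast
    have : (a:ℂ) ≠ 0 := by exact_mod_cast ha.ne'
    field_simp
    simp
  have hpa : 0 < Real.pi / a := by positivity
  have harg : Complex.arg (((Real.pi / a : ℝ) : ℂ) * (-Complex.I)) = -(Real.pi / 2) := by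
    rw [Complex.arg_real_mul _ hpa, Complex.arg_neg_I]
  have hnorm : ‖((Real.pi / a : ℝ) : ℂ) * (-Complex.I)‖ = Real.pi / a := by
    rw [norm_mul, Complex.norm_real, Real.norm_of_nonneg hpa.le]; simp
  have h5 : ((((Real.pi / a : ℝ) : ℂ) * (-Complex.I)) ^ ((1:ℂ)/2)).im
      = Real.sqrt (Real.pi / a) * (-(Real.sqrt 2 / 2)) := by
    have : ((1:ℂ)/2) = (((1:ℝ)/2 : ℝ) : ℂ) := by push_cast; rfl
    rw [this, Complex.cpow_ofReal_im, harg, hnorm, ← Real.sqrt_eq_rpow]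
    congr 1
    have : -(Real.pi / 2) * (1/2) = -(Real.pi / 4) := by ring
    rw [this, Real.sin_neg, Real.sin_pi_div_four]
  rw [h4]
  have h6 : ∀ z : ℂ, ((a:ℂ) * Complex.I * z).re = - a * z.im := by
    intro z; simp
  rw [h6, h5]
  symm
  rw [Real.sqrt_eq_iff_mul_self_eq (by positivity) (by simp; positivity)]
  have e1 : Real.sqrt (Real.pi / a) * Real.sqrt (Real.pi / a) = Real.pi / a := Real.mul_self_sqrt hpa.le
  have e2 : Real.sqrt 2 * Real.sqrt 2 = 2 := Real.mul_self_sqrt (by norm_num)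
  symm
  calc _ = a^2 * (Real.sqrt (Real.pi / a) * Real.sqrt (Real.pi / a)) * (Real.sqrt 2 * Real.sqrt 2) / 4 := by ring
    _ = _ := by rw [e1, e2]; field_simp; norm_num


noncomputable def bb (x : ℝ) : ℝ := Int.fract x * (1 - Int.fract x)

theorem bb_nonneg (x : ℝ) : 0 ≤ bb x :=
  mul_nonneg (Int.fract_nonneg x) (by linarith [Int.fract_lt_one x])

theorem bb_le_one (x : ℝ) : bb x ≤ 1 / 4 := by
  unfold bb; nlinarith [sq_nonneg (Int.fract x - 1/2)]

theorem bb_zero : bb 0 = 0 := by simp [bb]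

theorem bb_neg (x : ℝ) : bb (-x) = bb x := by
  unfold bb
  by_cases h : Int.fract x = 0
  · rw [h, Int.fract_neg_eq_zero.2 h]
  · rw [Int.fract_neg h]; ring

theorem bb_lip (x y : ℝ) : |bb x - bb y| ≤ |x - y| := by
  wlog hxy : x ≤ y generalizing x y
  · rw [abs_sub_comm, abs_sub_comm x]; exact this y x (by linarith)
  rw [abs_of_nonpos (by linarith : x - y ≤ 0)]
  have h1 := bb_nonneg x
  have h2 := bb_nonneg y
  have h3 := bb_le_one x
  have h4 := bb_le_one y
  rcases le_or_gt 1 (y - x) with h | h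
  · rw [abs_le]; constructor <;> linarith
  have fx := Int.floor_add_fract x
  have fy := Int.floor_add_fract y
  have a0 := Int.fract_nonneg x
  have a1 := Int.fract_lt_one x
  have b0 := Int.fract_nonneg y
  have b1 := Int.fract_lt_one y
  have hf : ⌊x⌋ ≤ ⌊y⌋ := Int.floor_le_floor hxy
  have hf2 : ⌊y⌋ ≤ ⌊x⌋ + 1 := by
    have : (⌊y⌋:ℝ) < ⌊x⌋ + 2 := by linarith
    have : ⌊y⌋ < ⌊x⌋ + 2 := by exact_mod_cast this
    omega
  rcases (by omega : ⌊y⌋ = ⌊x⌋ ∨ ⌊y⌋ = ⌊x⌋ + 1) with e | e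
  · have e' : (⌊y⌋:ℝ) = ⌊x⌋ := by exact_mod_cast e
    unfold bb
    rw [abs_le]
    have : 0 ≤ Int.fract y - Int.fract x := by linarith
    constructor <;> nlinarith
  · have e' : (⌊y⌋:ℝ) = ⌊x⌋ + 1 := by exact_mod_cast e
    unfold bb at *
    rw [abs_le]
    constructor <;> nlinarith

theorem bb_le_abs (x : ℝ) : bb x ≤ |x| := by
  have := bb_lip x 0
  rw [bb_zero, sub_zero, sub_zero, abs_of_nonneg (bb_nonneg x)] at this
  exact this

theorem bb_meas : Measurable bb := by
  unfold bb
  exact measurable_fract.mul (measurable_const.sub measurable_fract)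

theorem bb_fourier (x : ℝ) :
    HasSum (fun n : ℕ => (1 / Real.pi^2) * ((1 - Real.cos (2 * Real.pi * n * x)) / (n:ℝ)^2)) (bb x) := by
  have h1 := hasSum_zeta_two
  have h2 := hasSum_one_div_nat_pow_mul_cos (k := 1) (by norm_num) (x := Int.fract x)
    ⟨Int.fract_nonneg x, (Int.fract_lt_one x).le⟩
  have h3 := (h1.sub h2).mul_left (1 / Real.pi^2)
  have hv : (1 / Real.pi^2) * (Real.pi ^ 2 / 6 - (-1) ^ (1 + 1) * (2 * Real.pi) ^ (2 * 1) / 2 / ((2 * 1).factorial : ℝ) *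
      Polynomial.eval (Int.fract x) (Polynomial.map (algebraMap ℚ ℝ) (Polynomial.bernoulli (2 * 1)))) = bb x := by
    have : Polynomial.eval (Int.fract x) (Polynomial.map (algebraMap ℚ ℝ) (Polynomial.bernoulli (2 * 1)))
        = (Int.fract x)^2 - Int.fract x + 1/6 := by
      simp [Polynomial.bernoulli, Finset.sum_range_succ, bernoulli_one, bernoulli_two]
      ring
    rw [this]
    unfold bb
    have := Real.pi_ne_zero
    norm_num [Nat.factorial]
    field_simp
    ring
  rw [hv] at h3
  refine Eq.mpr (congrArg (fun f => HasSum f (bb x)) (funext fun n => ?_)) h3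
  have : Real.cos (2 * Real.pi * n * x) = Real.cos (2 * Real.pi * n * Int.fract x) := by
    have e : 2 * Real.pi * n * x = 2 * Real.pi * n * Int.fract x + (((n:ℤ) * ⌊x⌋ : ℤ) : ℝ) * (2 * Real.pi) := by
      have := Int.floor_add_fract x
      push_cast
      nth_rewrite 1 [← this]
      ring
    rw [e, Real.cos_add_int_mul_two_pi]
  rw [this]
  ring

theorem int_cos (a : ℝ) (ha : 0 < a) :
    MeasureTheory.IntegrableOn (fun s : ℝ => 1 - Real.cos (a / s^2)) (Set.Ioi 0) ∧
    ∫ s in Set.Ioi (0:ℝ), (1 - Real.cos (a / s^2)) = Real.sqrt (Real.pi * a / 2) := by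
  constructor
  · refine MeasureTheory.Integrable.mono' (g := fun s : ℝ => (2 * a + 2) * (1 + s^2)⁻¹)
      ((integrable_inv_one_add_sq.const_mul _).integrableOn) ?_ ?_
    · apply Measurable.aestronglyMeasurable
      fun_prop
    · refine (MeasureTheory.ae_restrict_iff' measurableSet_Ioi).2 (Filter.Eventually.of_forall fun s hs => ?_)
      have hs : 0 < s := hs
      have h1 := Real.cos_le_one (a / s^2)
      have h2 := Real.neg_one_le_cos (a / s^2)
      rw [Real.norm_of_nonneg (by linarith), ← div_eq_mul_inv, le_div_iff₀ (by positivity)]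
      have h3 : 1 - Real.cos (a / s^2) ≤ 2 * (a / s^2) := by
        obtain ⟨-, h⟩ := aux_norm_exp (((-(a / s^2) : ℝ) : ℂ) * Complex.I) (by rw [Complex.re_ofReal_mul]; simp)
        have h4 := (Complex.abs_re_le_norm _).trans h
        rw [← neg_mul, ← Complex.ofReal_neg, neg_neg, Complex.sub_re, Complex.exp_ofReal_mul_I_re, Complex.one_re,
          norm_mul, Complex.norm_I, Complex.norm_real, norm_neg, Real.norm_of_nonneg (by positivity), mul_one] at h4
        exact (le_abs_self _).trans h4
      have h5 : a / s^2 * s^2 = a := by field_simp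
      nlinarith [sq_nonneg s]
  · have h := MeasureTheory.integral_comp_rpow_Ioi (fun s : ℝ => 1 - Real.cos (a / s^2)) (p := -1) (by norm_num)
    rw [← h, ← aux_fres a ha]
    refine MeasureTheory.setIntegral_congr_fun measurableSet_Ioi fun s hs => ?_
    have hs : 0 < s := hs
    have e1 : s ^ ((-1:ℝ) - 1) = (s^2)⁻¹ := by
      rw [show (-1:ℝ) - 1 = -(2:ℕ) by norm_num, Real.rpow_neg hs.le, Real.rpow_natCast]
    simp only [e1, Real.rpow_neg_one, smul_eq_mul]
    have e2 : a / (s⁻¹)^2 = a * s^2 := by field_simp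
    rw [e2]
    norm_num
    ring

theorem int_bb (z : ℝ) (hz : 0 < z) :
    MeasureTheory.IntegrableOn (fun s : ℝ => bb (z / s^2)) (Set.Ioi 0) ∧
    ∫ s in Set.Ioi (0:ℝ), bb (z / s^2) = (riemannZeta (3/2)).re / Real.pi * Real.sqrt z := by
  constructor
  · refine MeasureTheory.Integrable.mono' (g := fun s : ℝ => (z + 1) * (1 + s^2)⁻¹)
      ((integrable_inv_one_add_sq.const_mul _).integrableOn) ?_ ?_
    · apply Measurable.aestronglyMeasurable
      exact bb_meas.comp (by fun_prop)
    · refine (MeasureTheory.ae_restrict_iff' measurableSet_Ioi).2 (Filter.Eventually.of_forall fun s hs => ?_)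
      have hs : 0 < s := hs
      have h1 := bb_nonneg (z / s^2)
      have h2 := bb_le_one (z / s^2)
      have h3 := bb_le_abs (z / s^2)
      rw [abs_of_pos (by positivity)] at h3
      rw [Real.norm_of_nonneg h1, ← div_eq_mul_inv, le_div_iff₀ (by positivity)]
      have h5 : z / s^2 * s^2 = z := by field_simp
      nlinarith [sq_nonneg s]
  · let F : ℕ → ℝ → ℝ := fun n s => (1 / Real.pi^2) * ((1 - Real.cos (2 * Real.pi * n * (z / s^2))) / (n:ℝ)^2)
    have hFn : ∀ n s, 0 ≤ F n s := by
      intro n s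
      have := Real.cos_le_one (2 * Real.pi * n * (z / s^2))
      have : 0 ≤ 1 - Real.cos (2 * Real.pi * n * (z / s^2)) := by linarith
      positivity
    have hF : ∀ n, MeasureTheory.IntegrableOn (F n) (Set.Ioi 0) ∧
        ∫ s in Set.Ioi (0:ℝ), F n s = Real.sqrt z / Real.pi * (1 / (n:ℝ) ^ ((3:ℝ)/2)) := by
      intro n
      rcases Nat.eq_zero_or_pos n with h | h
      · subst h
        have : F 0 = fun _ => 0 := by ext s; simp [F]
        rw [this]
        simp
      · have hn : (0:ℝ) < n := by exact_mod_cast h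
        have hp := Real.pi_pos
        obtain ⟨i1, i2⟩ := int_cos (2 * Real.pi * n * z) (by positivity)
        have e : F n = fun s => (1 / (Real.pi^2 * (n:ℝ)^2)) * (1 - Real.cos (2 * Real.pi * n * z / s^2)) := by
          ext s
          simp only [F]
          rw [← mul_div_assoc]
          field_simp
        rw [e]
        refine ⟨i1.const_mul _, ?_⟩
        rw [MeasureTheory.integral_const_mul, i2]
        have e1 : Real.pi * (2 * Real.pi * n * z) / 2 = Real.pi^2 * (n * z) := by ring
        rw [e1, Real.sqrt_mul (by positivity), Real.sqrt_sq hp.le, Real.sqrt_mul hn.le]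
        have e2 : (n:ℝ)^((3:ℝ)/2) = n * Real.sqrt n := by
          rw [show (3:ℝ)/2 = 1 + 1/2 by norm_num, Real.rpow_add hn, Real.rpow_one, Real.sqrt_eq_rpow]
        rw [e2]
        have e3 : Real.sqrt n * Real.sqrt n = n := Real.mul_self_sqrt hn.le
        have e4 : Real.sqrt n ≠ 0 := (Real.sqrt_pos.2 hn).ne'
        field_simp
        rw [sq, e3]
    have hs : Summable (fun n : ℕ => 1 / (n:ℝ) ^ ((3:ℝ)/2)) := Real.summable_one_div_nat_rpow.2 (by norm_num)
    have h := MeasureTheory.hasSum_integral_of_summable_integral_norm (F := F) (fun n => (hF n).1) (by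
      have : ∀ n, ∫ s in Set.Ioi (0:ℝ), ‖F n s‖ = Real.sqrt z / Real.pi * (1 / (n:ℝ) ^ ((3:ℝ)/2)) := by
        intro n
        rw [← (hF n).2]
        congr 1
        ext s
        exact Real.norm_of_nonneg (hFn n s)
      simp_rw [this]
      exact hs.mul_left _)
    simp_rw [fun n => (hF n).2] at h
    have e : ∀ s : ℝ, ∑' n, F n s = bb (z / s^2) := fun s => (bb_fourier (z / s^2)).tsum_eq
    simp_rw [e] at h
    have hz2 : (riemannZeta (3/2)).re = ∑' n : ℕ, 1 / (n:ℝ) ^ ((3:ℝ)/2) := by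
      rw [zeta_eq_tsum_one_div_nat_cpow (by norm_num)]
      have : ∀ n : ℕ, 1 / (n:ℂ) ^ ((3:ℂ)/2) = ((1 / (n:ℝ) ^ ((3:ℝ)/2) : ℝ) : ℂ) := by
        intro n
        rw [Complex.ofReal_div, Complex.ofReal_cpow (Nat.cast_nonneg n)]
        simp
      simp_rw [this]
      rw [← Complex.ofReal_tsum, Complex.ofReal_re]
    rw [hz2, h.unique (hs.hasSum.mul_left _)]
    ring


theorem bb_summable (z : ℝ) : Summable (fun n : ℕ => bb (z / (n:ℝ)^2)) := by
  have h : Summable (fun n : ℕ => |z| * (1 / (n:ℝ)^2)) :=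
    (Real.summable_one_div_nat_pow.2 (by norm_num)).mul_left _
  refine Summable.of_nonneg_of_le (fun n => bb_nonneg _) (fun n => ?_) h
  refine (bb_le_abs _).trans (le_of_eq ?_)
  rw [abs_div, abs_of_nonneg (sq_nonneg (n:ℝ))]; ring

theorem bb_sum_le (z : ℝ) (hz : 0 ≤ z) : ∑' n : ℕ, bb (z / (n:ℝ)^2) ≤ 2 * z := by
  have h : HasSum (fun n : ℕ => z * (1 / (n:ℝ)^2)) (z * (Real.pi^2/6)) := hasSum_zeta_two.mul_left z
  have h1 : ∑' n : ℕ, bb (z / (n:ℝ)^2) ≤ z * (Real.pi^2/6) := by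
    refine hasSum_le (fun n => ?_) (bb_summable z).hasSum h
    refine (bb_le_abs _).trans (le_of_eq ?_)
    rw [abs_of_nonneg (by positivity)]; ring
  have : Real.pi^2 ≤ 12 := by nlinarith [Real.pi_lt_d2, Real.pi_pos]
  nlinarith

theorem bb_sum_int (z : ℝ) (hz : 0 < z) (N : ℕ) (hN : 1 ≤ N) :
    |∑' n : ℕ, bb (z / (n:ℝ)^2) - (riemannZeta (3/2)).re / Real.pi * Real.sqrt z| ≤ N + z / (N:ℝ)^2 := by
  obtain ⟨hi, hv⟩ := int_bb z hz
  rw [← hv]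
  have t1 : Filter.Tendsto (fun M : ℕ => ∑ n ∈ Finset.range (M+1), bb (z / (n:ℝ)^2)) Filter.atTop
      (nhds (∑' n : ℕ, bb (z / (n:ℝ)^2))) :=
    (bb_summable z).hasSum.tendsto_sum_nat.comp (Filter.tendsto_add_atTop_nat 1)
  have t2 : Filter.Tendsto (fun M : ℕ => ∫ s in (0:ℝ)..(M:ℝ), bb (z / s^2)) Filter.atTop
      (nhds (∫ s in Set.Ioi (0:ℝ), bb (z / s^2))) :=
    MeasureTheory.intervalIntegral_tendsto_integral_Ioi 0 hi tendsto_natCast_atTop_atTop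
  refine le_of_tendsto ((t1.sub t2).abs) ?_
  filter_upwards [Filter.eventually_ge_atTop N] with M hM
  have hint : ∀ k : ℕ, IntervalIntegrable (fun s => bb (z / s^2)) MeasureTheory.volume (k:ℝ) ((k+1:ℕ):ℝ) := by
    intro k
    rw [intervalIntegrable_iff_integrableOn_Ioc_of_le (by push_cast; linarith)]
    exact hi.mono_set fun s hs => lt_of_le_of_lt (Nat.cast_nonneg k) hs.1
  have hsplit := intervalIntegral.sum_integral_adjacent_intervals (f := fun s => bb (z / s^2))
    (μ := MeasureTheory.volume) (a := fun k : ℕ => (k:ℝ)) (n := M) (fun k _ => hint k)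
  simp only [Nat.cast_zero] at hsplit
  rw [← hsplit, Finset.sum_range_succ']
  simp only [Nat.cast_zero, ne_eq, OfNat.ofNat_ne_zero, not_false_eq_true, zero_pow, div_zero, bb_zero, add_zero]
  rw [← Finset.sum_sub_distrib]
  refine (Finset.abs_sum_le_sum_abs _ _).trans ?_
  let e : ℕ → ℝ := fun n => if n < N then 1 else z / (n:ℝ)^2 - z / ((n+1:ℕ):ℝ)^2
  have hterm : ∀ n : ℕ, |bb (z / ((n+1:ℕ):ℝ)^2) - ∫ s in (n:ℝ)..((n+1:ℕ):ℝ), bb (z / s^2)| ≤ e n := by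
    intro n
    have h1 : bb (z / ((n+1:ℕ):ℝ)^2) = ∫ s in (n:ℝ)..((n+1:ℕ):ℝ), bb (z / ((n+1:ℕ):ℝ)^2) := by
      rw [intervalIntegral.integral_const]; push_cast; simp
    rw [h1, ← intervalIntegral.integral_sub (by simp) (hint n)]
    have hb := intervalIntegral.norm_integral_le_of_norm_le_const (a := (n:ℝ)) (b := ((n+1:ℕ):ℝ)) (C := e n)
      (f := fun s => bb (z / ((n+1:ℕ):ℝ)^2) - bb (z / s^2)) ?_
    · rw [Real.norm_eq_abs] at hb
      refine hb.trans (le_of_eq ?_)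
      push_cast; simp
    · intro s hs
      rw [Set.uIoc_of_le (by push_cast; linarith)] at hs
      have hs0 : 0 < s := lt_of_le_of_lt (Nat.cast_nonneg n) hs.1
      rw [Real.norm_eq_abs]
      simp only [e]
      split_ifs with hc
      · rw [abs_le]
        have := bb_nonneg (z / s^2)
        have := bb_le_one (z / s^2)
        have := bb_nonneg (z / ((n+1:ℕ):ℝ)^2)
        have := bb_le_one (z / ((n+1:ℕ):ℝ)^2)
        constructor <;> linarith
      · have hn : (0:ℝ) < n := by
          have : 0 < n := by omega
          exact_mod_cast this
        refine (bb_lip _ _).trans ?_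
        have g1 : z / ((n+1:ℕ):ℝ)^2 ≤ z / s^2 := by
          have := hs.2
          gcongr
        have g2 : z / s^2 ≤ z / (n:ℝ)^2 := by
          have := hs.1.le
          gcongr
        rw [abs_le]; constructor <;> linarith
  refine (Finset.sum_le_sum fun n _ => hterm n).trans ?_
  have hsum : ∀ M, N ≤ M → ∑ n ∈ Finset.range M, e n ≤ N + (z / (N:ℝ)^2 - z / (M:ℝ)^2) := by
    intro M hM
    induction M, hM using Nat.le_induction with
    | base =>
      rw [Finset.sum_congr rfl (g := fun _ => (1:ℝ))]
      · simp
      · intro n hn; simp [e, Finset.mem_range.1 hn]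
    | succ k hk ih =>
      rw [Finset.sum_range_succ]
      have : e k = z / (k:ℝ)^2 - z / ((k+1:ℕ):ℝ)^2 := by
        simp only [e]; rw [if_neg (by omega)]
      linarith
  have := hsum M hM
  have : 0 ≤ z / (M:ℝ)^2 := by positivity
  linarith

theorem bb_asymp : ∃ C : ℝ, 0 < C ∧ ∀ z : ℝ, 0 ≤ z →
    |∑' n : ℕ, bb (z / (n:ℝ)^2) - (riemannZeta (3/2)).re / Real.pi * Real.sqrt z| ≤ C * z ^ ((1:ℝ)/3) := by
  set K := (riemannZeta (3/2)).re / Real.pi with hK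
  refine ⟨|K| + 3, by positivity, fun z hz => ?_⟩
  rcases hz.eq_or_lt with h | h
  · subst h; simp [bb_zero]
  have hc : (z ^ ((1:ℝ)/3))^3 = z := by
    rw [← Real.rpow_natCast, ← Real.rpow_mul hz]; norm_num
  set c := z ^ ((1:ℝ)/3) with hcdef
  have hc0 : 0 < c := Real.rpow_pos_of_pos h _
  rcases le_or_gt 1 z with h1 | h1
  · have hc1 : 1 ≤ c := Real.one_le_rpow h1 (by norm_num)
    have hb := bb_sum_int z h ⌈c⌉₊ (Nat.one_le_iff_ne_zero.2 (Nat.ceil_pos.2 hc0).ne')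
    have hN1 : c ≤ (⌈c⌉₊:ℝ) := Nat.le_ceil c
    have hN2 : (⌈c⌉₊:ℝ) < c + 1 := Nat.ceil_lt_add_one hc0.le
    have h2 : z / (⌈c⌉₊:ℝ)^2 ≤ c := by
      rw [div_le_iff₀ (by positivity)]
      calc z = c * c^2 := by rw [← hc]; ring
        _ ≤ _ := by gcongr
    have : 0 ≤ |K| * c := by positivity
    linarith
  · have h2 := bb_sum_le z hz
    have h3 : 0 ≤ ∑' n : ℕ, bb (z / (n:ℝ)^2) := tsum_nonneg fun n => bb_nonneg _
    have hz3 : z ≤ c := by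
      have := Real.rpow_le_rpow_of_exponent_ge h h1.le (show (1:ℝ)/3 ≤ 1 by norm_num)
      rwa [Real.rpow_one] at this
    have hz4 : Real.sqrt z ≤ c := by
      rw [Real.sqrt_eq_rpow]
      exact Real.rpow_le_rpow_of_exponent_ge h h1.le (by norm_num)
    refine (abs_sub _ _).trans ?_
    rw [abs_of_nonneg h3, abs_mul, abs_of_nonneg (Real.sqrt_nonneg z)]
    have : |K| * Real.sqrt z ≤ |K| * c := by gcongr
    linarith


theorem sum_pos_part (N : ℕ) (x : ℝ) (h1 : x ≤ N) (h2 : -(N:ℝ) ≤ x) :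
    ∑ k ∈ Finset.Icc (-(N:ℤ)) N, max ((k:ℝ) + x) 0 = ((N + x) * (N + x + 1) + bb x) / 2 := by
  have hn1 : ⌊x⌋ ≤ (N:ℤ) := by
    have := Int.floor_le x
    have : (⌊x⌋:ℝ) ≤ ((N:ℤ):ℝ) := by push_cast; linarith
    exact_mod_cast this
  have hn2 : -(N:ℤ) ≤ ⌊x⌋ := by
    rw [Int.le_floor]; push_cast; exact h2
  obtain ⟨L, hL⟩ := Int.eq_ofNat_of_zero_le (by omega : 0 ≤ (N:ℤ) + ⌊x⌋)
  have hsub : (Finset.range (L+1)).image (fun j : ℕ => -⌊x⌋ + (j:ℤ)) ⊆ Finset.Icc (-(N:ℤ)) N := by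
    intro k hk
    simp only [Finset.mem_image, Finset.mem_range] at hk
    obtain ⟨j, hj, rfl⟩ := hk
    rw [Finset.mem_Icc]; omega
  have hfl := Int.floor_add_fract x
  have hf0 := Int.fract_nonneg x
  have hf1 := Int.fract_lt_one x
  rw [← Finset.sum_subset hsub, Finset.sum_image (by intro a _ b _ h; simpa using h)]
  · have e : ∀ j ∈ Finset.range (L+1), max ((((-⌊x⌋ + (j:ℤ) : ℤ)):ℝ) + x) 0 = (j:ℝ) + Int.fract x := by
      intro j _
      have hj : (0:ℝ) ≤ j := Nat.cast_nonneg j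
      push_cast
      rw [max_eq_left (by linarith)]; linarith
    rw [Finset.sum_congr rfl e, Finset.sum_add_distrib]
    have hg : ∑ j ∈ Finset.range (L+1), (j:ℝ) = L * (L+1) / 2 := by
      clear hsub e hL
      induction L with
      | zero => simp
      | succ k ih => rw [Finset.sum_range_succ, ih]; push_cast; ring
    rw [hg]
    simp only [Finset.sum_const, Finset.card_range, nsmul_eq_mul]
    have hL' : (N:ℝ) + ⌊x⌋ = L := by exact_mod_cast hL
    unfold bb
    have : x = L - N + Int.fract x := by linarith
    generalize Int.fract x = θ at *
    subst this
    push_cast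
    ring
  · intro k hk hk2
    rw [Finset.mem_Icc] at hk
    apply max_eq_right
    have : k < -⌊x⌋ := by
      by_contra hcon
      push Not at hcon
      apply hk2
      simp only [Finset.mem_image, Finset.mem_range]
      exact ⟨(k + ⌊x⌋).toNat, by omega, by omega⟩
    have : (k:ℝ) ≤ -⌊x⌋ - 1 := by
      have : k ≤ -⌊x⌋ - 1 := by omega
      exact_mod_cast this
    linarith

theorem lin_id1 (M X u : ℝ) (hX : 0 < X) (hM : X ≤ M) :
    max (min M (X - u) - max 0 (-u)) 0 =
      max (u + M) 0 - max (u + M - X) 0 - max u 0 + max (u - X) 0 := by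
  grind

theorem lin_id2 (M X u : ℝ) (hX : 0 < X) (hM : X ≤ M) :
    - max (min M u - max 0 (u - X)) 0 =
      max (u - M) 0 - max (u - M - X) 0 - max u 0 + max (u - X) 0 := by
  grind

theorem Ilen_formula (X : ℝ) (hX : 0 < X) (m : ℤ) (hm : m ≠ 0) (q : ℕ) (l : ℤ) :
    Ilen X m q l = (max ((l:ℝ) * q + m * X) 0 - max ((l:ℝ) * q + (m - 1) * X) 0
      - max ((l:ℝ) * q + 0) 0 + max ((l:ℝ) * q + -X) 0) / m := by
  unfold Ilen
  set u : ℝ := (l:ℝ) * q with hu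
  rcases lt_or_gt_of_ne hm with h | h
  · have hm1 : (m:ℝ) ≤ -1 := by
      have : m ≤ -1 := by omega
      exact_mod_cast this
    have hset : {t : ℝ | 0 < t ∧ t < X ∧ 0 < (m:ℝ) * t + u ∧ (m:ℝ) * t + u < X}
        = Set.Ioo (max 0 ((X - u) / m)) (min X (-u / m)) := by
      ext t
      simp only [Set.mem_ofPred_eq, Set.mem_Ioo, max_lt_iff, lt_min_iff]
      rw [div_lt_iff_of_neg (by linarith), lt_div_iff_of_neg (by linarith)]
      constructor
      · rintro ⟨a, b, c, d⟩; exact ⟨⟨a, by linarith⟩, b, by linarith⟩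
      · rintro ⟨⟨a, b⟩, c, d⟩; exact ⟨a, c, by linarith, by linarith⟩
    rw [hset, Real.volume_Ioo, ENNReal.toReal_ofReal', eq_div_iff (by linarith)]
    have hm0 : (0:ℝ) ≤ -m := by linarith
    have hmne : (m:ℝ) ≠ 0 := by linarith
    have e1 : -(m:ℝ) * ((X - u) / m) = u - X := by field_simp; ring
    have e2 : -(m:ℝ) * (-u / m) = u := by field_simp
    have e3 : max (min X (-u / m) - max 0 ((X - u) / m)) 0 * (m:ℝ)
        = - max (min (-m * X) u - max 0 (u - X)) 0 := by
      rw [← neg_inj, neg_neg, ← mul_neg, mul_comm, mul_max_of_nonneg _ _ hm0, mul_sub, mul_min_of_nonneg _ _ hm0,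
        mul_max_of_nonneg _ _ hm0, e1, e2, mul_zero]
    rw [e3, lin_id2 (-m * X) X u hX (by nlinarith)]
    ring_nf
  · have hm1 : (1:ℝ) ≤ m := by
      have : 1 ≤ m := by omega
      exact_mod_cast this
    have hset : {t : ℝ | 0 < t ∧ t < X ∧ 0 < (m:ℝ) * t + u ∧ (m:ℝ) * t + u < X}
        = Set.Ioo (max 0 (-u / m)) (min X ((X - u) / m)) := by
      ext t
      simp only [Set.mem_ofPred_eq, Set.mem_Ioo, max_lt_iff, lt_min_iff]
      rw [div_lt_iff₀ (by linarith), lt_div_iff₀ (by linarith)]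
      constructor
      · rintro ⟨a, b, c, d⟩; exact ⟨⟨a, by linarith⟩, b, by linarith⟩
      · rintro ⟨⟨a, b⟩, c, d⟩; exact ⟨a, c, by linarith, by linarith⟩
    rw [hset, Real.volume_Ioo, ENNReal.toReal_ofReal', eq_div_iff (by linarith)]
    have hm0 : (0:ℝ) ≤ m := by linarith
    have hmne : (m:ℝ) ≠ 0 := by linarith
    have e1 : (m:ℝ) * ((X - u) / m) = X - u := by field_simp
    have e2 : (m:ℝ) * (-u / m) = -u := by field_simp
    have e3 : max (min X ((X - u) / m) - max 0 (-u / m)) 0 * (m:ℝ)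
        = max (min (m * X) (X - u) - max 0 (-u)) 0 := by
      rw [mul_comm, mul_max_of_nonneg _ _ hm0, mul_sub, mul_min_of_nonneg _ _ hm0, mul_max_of_nonneg _ _ hm0,
        e1, e2, mul_zero]
    rw [e3, lin_id1 (m * X) X u hX (by nlinarith)]
    ring_nf

theorem Ilen_zero (X : ℝ) (hX : 0 < X) (m : ℤ) (q : ℕ) (l : ℤ) (N : ℕ)
    (hN : (|(m:ℝ)| + 1) * X ≤ N * q) (hl : (N:ℤ) < |l|) : Ilen X m q l = 0 := by
  unfold Ilen
  have : {t : ℝ | 0 < t ∧ t < X ∧ 0 < (m:ℝ) * t + (l:ℝ) * q ∧ (m:ℝ) * t + (l:ℝ) * q < X} = ∅ := by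
    ext t
    simp only [Set.mem_ofPred_eq, Set.mem_empty_iff_false, iff_false]
    rintro ⟨a, b, c, d⟩
    have h1 : |(l:ℝ) * q| < (|(m:ℝ)| + 1) * X := by
      have h2 : |(m:ℝ) * t| ≤ |(m:ℝ)| * X := by
        rw [abs_mul, abs_of_pos a]; gcongr
      have h3 := abs_le.1 h2
      rw [abs_lt]; constructor <;> linarith [h3.1, h3.2]
    rw [abs_mul, abs_of_nonneg (Nat.cast_nonneg (α := ℝ) q)] at h1
    have h4 : (N:ℝ) ≤ |(l:ℝ)| := by
      have : ((N:ℤ):ℝ) ≤ ((|l| : ℤ) : ℝ) := by exact_mod_cast hl.le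
      simpa using this
    have : (N:ℝ) * q ≤ |(l:ℝ)| * q := by gcongr
    linarith
  rw [this]; simp

noncomputable def be (m : ℤ) (y : ℝ) : ℝ := bb (m * y) - bb ((m - 1) * y) + bb y

theorem sum_Ilen (X : ℝ) (hX : 0 < X) (m : ℤ) (hm : m ≠ 0) (q : ℕ) (hq : 1 ≤ q) (D : ℕ) (hD : 1 ≤ D) (N : ℕ)
    (hN : (|(m:ℝ)| + 1) * X ≤ N * q) :
    ∑ l ∈ Finset.Icc (-(N:ℤ)) N, (if (D:ℤ) ∣ l then Ilen X m q l else 0) =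
      X^2 / (q * D) + q * D / (2 * m) * be m (X / (q * D)) := by
  have hqr : (1:ℝ) ≤ q := by exact_mod_cast hq
  have hDr : (1:ℝ) ≤ D := by exact_mod_cast hD
  have hmr : (m:ℝ) ≠ 0 := by exact_mod_cast hm
  have hD0 : (D:ℤ) ≠ 0 := by omega
  have s1 : ∑ l ∈ Finset.Icc (-(N:ℤ)) N, (if (D:ℤ) ∣ l then Ilen X m q l else 0)
      = ∑' l : ℤ, (if (D:ℤ) ∣ l then Ilen X m q l else 0) := by
    symm
    apply tsum_eq_sum
    intro l hl
    rw [Ilen_zero X hX m q l N hN]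
    · simp
    · by_contra hc
      exact hl (Finset.mem_Icc.2 (abs_le.1 (not_lt.1 hc)))
  have hinj : Function.Injective (fun k : ℤ => k * (D:ℤ)) := mul_left_injective₀ hD0
  have s2 : ∑' l : ℤ, (if (D:ℤ) ∣ l then Ilen X m q l else 0) = ∑' k : ℤ, Ilen X m q (k * D) := by
    rw [← hinj.tsum_eq (f := fun l : ℤ => if (D:ℤ) ∣ l then Ilen X m q l else 0)]
    · simp
    · intro l hl
      rw [Function.mem_support] at hl
      have : (D:ℤ) ∣ l := by
        by_contra hc
        exact hl (if_neg hc)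
      obtain ⟨k, rfl⟩ := this
      exact ⟨k, mul_comm _ _⟩
  have s3 : ∑' k : ℤ, Ilen X m q (k * D) = ∑ k ∈ Finset.Icc (-(N:ℤ)) N, Ilen X m q (k * D) := by
    apply tsum_eq_sum
    intro l hl
    apply Ilen_zero X hX m q _ N hN
    have : (N:ℤ) < |l| := by
      by_contra hc
      exact hl (Finset.mem_Icc.2 (abs_le.1 (not_lt.1 hc)))
    rw [abs_mul]
    have : (1:ℤ) ≤ |(D:ℤ)| := by rw [abs_of_nonneg (by omega)]; omega
    nlinarith [abs_nonneg l]
  rw [s1, s2, s3]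
  set d : ℝ := q * D with hd
  have hd1 : 1 ≤ d := by nlinarith
  set Z : ℝ := X / d with hZ
  have hXZ : X = d * Z := by rw [hZ]; field_simp
  have hZ0 : 0 < Z := by positivity
  have hNZ : (|(m:ℝ)| + 1) * Z ≤ N := by
    have h1 : (|(m:ℝ)| + 1) * Z * d ≤ N * d := by
      calc _ = (|(m:ℝ)| + 1) * X := by rw [hXZ]; ring
        _ ≤ N * q := hN
        _ ≤ N * q * D := le_mul_of_one_le_right (by positivity) hDr
        _ = _ := by rw [hd]; ring
    exact le_of_mul_le_mul_right h1 (by linarith)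
  have hterm : ∀ k : ℤ, Ilen X m q (k * D) = (d / m) * (max ((k:ℝ) + m * Z) 0 - max ((k:ℝ) + (m - 1) * Z) 0
      - max ((k:ℝ) + 0) 0 + max ((k:ℝ) + -Z) 0) := by
    intro k
    rw [Ilen_formula X hX m hm]
    have g : ∀ x : ℝ, max (((k * (D:ℤ) : ℤ):ℝ) * q + d * x) 0 = d * max ((k:ℝ) + x) 0 := by
      intro x
      rw [mul_max_of_nonneg _ _ (by linarith), mul_zero]
      congr 1
      rw [hd]; push_cast; ring
    have g1 := g (m * Z)
    have g2 := g ((m-1) * Z)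
    have g3 := g 0
    have g4 := g (-Z)
    rw [show (m:ℝ) * X = d * (m * Z) by rw [hXZ]; ring, show ((m:ℝ)-1) * X = d * ((m-1) * Z) by rw [hXZ]; ring,
      show -X = d * (-Z) by rw [hXZ]; ring, g1, g2, g4]
    rw [mul_zero] at g3
    rw [g3]
    ring
  rw [Finset.sum_congr rfl (fun k _ => hterm k), ← Finset.mul_sum, Finset.sum_add_distrib,
    Finset.sum_sub_distrib, Finset.sum_sub_distrib]
  have hmZ : |(m:ℝ) * Z| = |(m:ℝ)| * Z := by rw [abs_mul, abs_of_pos hZ0]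
  have b1 := abs_le.1 hmZ.le
  have hnn : 0 ≤ |(m:ℝ)| * Z := by positivity
  rw [sum_pos_part N _ (by nlinarith) (by nlinarith), sum_pos_part N _ (by nlinarith) (by nlinarith),
    sum_pos_part N _ (by nlinarith) (by nlinarith), sum_pos_part N _ (by nlinarith) (by nlinarith)]
  rw [bb_zero, bb_neg]
  unfold be
  rw [hXZ]
  field_simp
  ring


noncomputable def mkf (loc : ℕ → ℕ → ℝ) : ArithmeticFunction ℝ :=
  ⟨fun n => if n = 0 then 0 else n.factorization.prod loc, by simp⟩

theorem mkf_apply (loc : ℕ → ℕ → ℝ) {n : ℕ} (hn : n ≠ 0) : mkf loc n = n.factorization.prod loc := by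
  change (if n = 0 then 0 else n.factorization.prod loc) = _
  rw [if_neg hn]

theorem mkf_mult (loc : ℕ → ℕ → ℝ) : (mkf loc).IsMultiplicative := by
  rw [ArithmeticFunction.IsMultiplicative.iff_ne_zero]
  constructor
  · rw [mkf_apply _ one_ne_zero]; simp
  · intro a b ha hb hab
    rw [mkf_apply _ (mul_ne_zero ha hb), mkf_apply _ ha, mkf_apply _ hb, Nat.factorization_mul_of_coprime hab]
    apply Finsupp.prod_add_index_of_disjoint
    simpa using hab.disjoint_primeFactors

theorem mkf_pow (loc : ℕ → ℕ → ℝ) (h0 : ∀ p, loc p 0 = 1) {p : ℕ} (hp : p.Prime) (k : ℕ) :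
    mkf loc (p ^ k) = loc p k := by
  rw [mkf_apply _ (pow_ne_zero _ hp.ne_zero), hp.factorization_pow, Finsupp.prod_single_index (h0 p)]

theorem summ_of_bound (f : ℕ → ℝ) (hnn : ∀ n, 0 ≤ f n) (f0 : f 0 = 0) (f1 : f 1 = 1)
    (hmul : ∀ {a b : ℕ}, a.Coprime b → f (a * b) = f a * f b)
    (hfin : ∀ p : ℕ, p.Prime → ∀ e, 5 ≤ e → f (p^e) = 0) (B : ℝ)
    (hB : ∀ S : Finset ℕ, (∀ p ∈ S, p.Prime) → ∏ p ∈ S, ∑ e ∈ Finset.range 5, f (p^e) ≤ B) :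
    Summable f ∧ ∑' n, f n ≤ B := by
  have hts : ∀ p : ℕ, p.Prime → HasSum (fun e => f (p^e)) (∑ e ∈ Finset.range 5, f (p^e)) := by
    intro p hp
    apply hasSum_sum_of_ne_finset_zero
    intro e he
    apply hfin p hp
    simpa using he
  have key : ∀ T : Finset ℕ, ∑ n ∈ T, f n ≤ B := by
    intro T
    obtain ⟨N, hN⟩ : ∃ N, ∀ n ∈ T, n < N := ⟨T.sup id + 1, fun n hn => Nat.lt_succ_of_le (Finset.le_sup (f := id) hn)⟩
    have h := (EulerProduct.summable_and_hasSum_smoothNumbers_prod_primesBelow_tsum f1 hmul (fun {p} hp => by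
      simp_rw [Real.norm_of_nonneg (hnn _)]; exact (hts p hp).summable) N).2
    have h2 : HasSum (Set.indicator (N.smoothNumbers) f) (∏ p ∈ N.primesBelow, ∑' n : ℕ, f (p ^ n)) :=
      (hasSum_subtype_iff_indicator).1 h
    have h3 : ∑ n ∈ T, f n ≤ ∑ n ∈ T, Set.indicator (N.smoothNumbers) f n := by
      refine Finset.sum_le_sum fun n hn => ?_
      rcases Nat.eq_zero_or_pos n with h | h
      · subst h; rw [f0]; exact Set.indicator_nonneg (fun _ _ => hnn _) _
      · rw [Set.indicator_of_mem]
        exact Nat.mem_smoothNumbers_of_lt h (hN n hn)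
    refine h3.trans ((sum_le_hasSum T (fun n _ => Set.indicator_nonneg (fun _ _ => hnn _) _) h2).trans ?_)
    rw [Finset.prod_congr rfl (fun p hp => (hts p (Nat.prime_of_mem_primesBelow hp)).tsum_eq)]
    exact hB _ fun p hp => Nat.prime_of_mem_primesBelow hp
  have hs := summable_of_sum_le hnn key
  exact ⟨hs, hs.tsum_le_of_sum_le key⟩

noncomputable def rsum : ℝ := ∑' n : ℕ, 6 * (n:ℝ) ^ (-(4:ℝ)/3)

theorem rsum_summable : Summable (fun n : ℕ => 6 * (n:ℝ) ^ (-(4:ℝ)/3)) :=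
  (Real.summable_nat_rpow.2 (by norm_num)).mul_left 6

theorem summ_main (m : ℤ) (hm : m ≠ 0) (q : ℕ) (hq : 1 ≤ q) (f : ℕ → ℝ) (hnn : ∀ n, 0 ≤ f n) (f0 : f 0 = 0) (f1 : f 1 = 1)
    (hmul : ∀ {a b : ℕ}, a.Coprime b → f (a * b) = f a * f b)
    (hfin : ∀ p : ℕ, p.Prime → ∀ e, 5 ≤ e → f (p^e) = 0)
    (hL : ∀ p : ℕ, p.Prime → ∑ e ∈ Finset.range 5, f (p^e) ≤ (1 + 6 * (p:ℝ) ^ (-(4:ℝ)/3)) *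
      (if p ∣ m.natAbs then 9 else 1) * (if p ∣ q then 2 else 1)) :
    Summable f ∧ ∑' n, f n ≤ Real.exp rsum * 9 ^ (m.natAbs.primeFactors.card) * 2 ^ (q.primeFactors.card) := by
  have hite : ∀ (S : Finset ℕ) (n : ℕ) (c : ℝ), 1 ≤ c → n ≠ 0 → (∀ p ∈ S, p.Prime) →
      ∏ p ∈ S, (if p ∣ n then c else 1) ≤ c ^ (n.primeFactors.card) := by
    intro S n c hc hn hS
    rw [Finset.prod_ite, Finset.prod_const, Finset.prod_const_one, mul_one]
    apply pow_le_pow_right₀ hc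
    apply Finset.card_le_card
    intro p hp
    rw [Finset.mem_filter] at hp
    exact Nat.mem_primeFactors.2 ⟨hS p hp.1, hp.2, hn⟩
  refine summ_of_bound f hnn f0 f1 hmul hfin _ fun S hS => ?_
  refine (Finset.prod_le_prod (fun p hp => Finset.sum_nonneg fun _ _ => hnn _) (fun p hp => hL p (hS p hp))).trans ?_
  rw [Finset.prod_mul_distrib, Finset.prod_mul_distrib]
  have h1 : ∏ p ∈ S, (1 + 6 * (p:ℝ) ^ (-(4:ℝ)/3)) ≤ Real.exp rsum := by
    refine (Finset.prod_le_prod (fun p hp => by positivity) (fun p hp => ?_ : ∀ p ∈ S, _ ≤ Real.exp (6 * (p:ℝ) ^ (-(4:ℝ)/3)))).trans ?_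
    · rw [add_comm]; exact Real.add_one_le_exp _
    · rw [← Real.exp_sum]
      apply Real.exp_le_exp.2
      exact rsum_summable.sum_le_tsum S fun n _ => by positivity
  have h2 := hite S m.natAbs 9 (by norm_num) (Int.natAbs_ne_zero.2 hm) hS
  have h3 := hite S q 2 (by norm_num) (by omega) hS
  have n2 : 0 ≤ ∏ p ∈ S, (if p ∣ m.natAbs then (9:ℝ) else 1) :=
    Finset.prod_nonneg fun p _ => by split_ifs <;> norm_num
  have n3 : 0 ≤ ∏ p ∈ S, (if p ∣ q then (2:ℝ) else 1) :=
    Finset.prod_nonneg fun p _ => by split_ifs <;> norm_num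
  have := Real.exp_pos rsum
  gcongr

theorem two_pow_le_divisors (q : ℕ) (hq : 1 ≤ q) : (2:ℝ) ^ (q.primeFactors.card) ≤ q.divisors.card := by
  rw [Nat.card_divisors (by omega)]
  have : 2 ^ (q.primeFactors.card) ≤ ∏ p ∈ q.primeFactors, (q.factorization p + 1) := by
    rw [← Finset.prod_const]
    refine Finset.prod_le_prod' fun p hp => ?_
    have := (Nat.prime_of_mem_primeFactors hp).factorization_pos_of_dvd (by omega) (Nat.dvd_of_mem_primeFactors hp)
    omega
  exact_mod_cast this

noncomputable def aloc (m : ℤ) (q : ℕ) (p e : ℕ) : ℝ :=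
  if e = 0 then 1 else if p ∣ m.natAbs then
    (if e = 1 then -(p:ℝ) / ((p:ℝ)^2 - 1) else if e = 2 then 1 / ((p:ℝ)^2 - 1) else 0)
  else if p ∣ q then 0 else if e = 2 then 1 / ((p:ℝ)^2 - 2) else 0

noncomputable def wloc (m : ℤ) (q : ℕ) (p e : ℕ) : ℝ := (p:ℝ)^e * aloc m q p e

noncomputable def vloc (m : ℤ) (q : ℕ) (p e : ℕ) : ℝ :=
  wloc m q p e - (if 2 ≤ e then wloc m q p (e - 2) else 0)

theorem aloc_zero (m q p) : aloc m q p 0 = 1 := by simp [aloc]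
theorem wloc_zero (m q p) : wloc m q p 0 = 1 := by simp [wloc, aloc]
theorem vloc_zero (m q p) : vloc m q p 0 = 1 := by simp [vloc, wloc, aloc]
theorem aloc_big (m q p e) (he : 3 ≤ e) : aloc m q p e = 0 := by
  unfold aloc; rw [if_neg (by omega), if_neg (by omega : ¬ e = 1), if_neg (by omega : ¬ e = 2)]
  simp [show ¬ e = 2 by omega]
theorem vloc_big (m q p e) (he : 5 ≤ e) : vloc m q p e = 0 := by
  unfold vloc wloc; rw [aloc_big m q p e (by omega), aloc_big m q p (e-2) (by omega)]; simp

theorem wf_eq (m : ℤ) (q n : ℕ) : mkf (wloc m q) n = n * mkf (aloc m q) n := by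
  rcases eq_or_ne n 0 with h | h
  · subst h; simp
  · rw [mkf_apply _ h, mkf_apply _ h]
    unfold wloc
    rw [Finsupp.prod_mul]
    congr 1
    conv_rhs => rw [← Nat.prod_factorization_pow_eq_self h]
    simp [Finsupp.prod]

noncomputable def sqf : ArithmeticFunction ℝ := ⟨fun n => if n ≠ 0 ∧ IsSquare n then 1 else 0, by simp⟩

theorem sqf_apply (n : ℕ) : sqf n = if n ≠ 0 ∧ IsSquare n then 1 else 0 := rfl

theorem sqf_mult : sqf.IsMultiplicative := by
  rw [ArithmeticFunction.IsMultiplicative.iff_ne_zero]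
  constructor
  · simp [sqf_apply]
  · intro a b ha hb hab
    have : IsSquare (a * b) ↔ IsSquare a ∧ IsSquare b := by
      constructor
      · rintro ⟨c, hc⟩
        have h1 := exists_eq_pow_of_mul_eq_pow (Nat.isUnit_iff.2 hab) (hc.trans (sq c).symm)
        have h2 := exists_eq_pow_of_mul_eq_pow (Nat.isUnit_iff.2 hab.symm) ((mul_comm b a).trans (hc.trans (sq c).symm))
        obtain ⟨x, hx⟩ := h1
        obtain ⟨y, hy⟩ := h2
        exact ⟨⟨x, hx.trans (sq x)⟩, ⟨y, hy.trans (sq y)⟩⟩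
      · rintro ⟨⟨x, hx⟩, ⟨y, hy⟩⟩
        exact ⟨x * y, by rw [hx, hy]; ring⟩
    simp only [sqf_apply, this]
    by_cases h1 : IsSquare a <;> by_cases h2 : IsSquare b <;> simp [ha, hb, h1, h2]

theorem sqf_pow {p : ℕ} (hp : p.Prime) (k : ℕ) : sqf (p^k) = if Even k then 1 else 0 := by
  rw [sqf_apply]
  have : (p^k ≠ 0 ∧ IsSquare (p^k)) ↔ Even k := by
    constructor
    · rintro ⟨-, c, hc⟩
      have hc0 : c ≠ 0 := by
        rintro rfl
        exact (pow_ne_zero k hp.ne_zero) (by simpa using hc)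
      have := congrArg (fun n => n.factorization p) hc
      simp only [Nat.factorization_mul hc0 hc0, hp.factorization_pow, Finsupp.single_eq_same, Finsupp.add_apply] at this
      exact ⟨_, this⟩
    · rintro ⟨j, rfl⟩
      exact ⟨pow_ne_zero _ hp.ne_zero, p^j, by rw [pow_add]⟩
  simp only [this]

theorem vsq (m : ℤ) (q : ℕ) : mkf (vloc m q) * sqf = mkf (wloc m q) := by
  rw [ArithmeticFunction.IsMultiplicative.eq_iff_eq_on_prime_powers _ ((mkf_mult _).mul sqf_mult) _ (mkf_mult _)]
  intro p k hp
  rw [mkf_pow _ (wloc_zero m q) hp, ArithmeticFunction.mul_apply,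
    Nat.sum_divisorsAntidiagonal (fun a b => mkf (vloc m q) a * sqf b), Nat.divisors_prime_pow hp, Finset.sum_map]
  simp only [Function.Embedding.coeFn_mk]
  have e : ∀ i ∈ Finset.range (k+1), mkf (vloc m q) (p^i) * sqf (p^k / p^i) =
      vloc m q p i * (if Even (k - i) then 1 else 0) := by
    intro i hi
    have : i ≤ k := by simpa [Nat.lt_succ_iff] using hi
    rw [mkf_pow _ (vloc_zero m q) hp, Nat.pow_div this hp.pos, sqf_pow hp]
  rw [Finset.sum_congr rfl e]
  clear e
  induction k using Nat.strong_induction_on with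
  | _ k ih =>
    match k with
    | 0 => simp [vloc_zero, wloc_zero]
    | 1 => simp [Finset.sum_range_succ, vloc]
    | k + 2 =>
      have := ih k (by omega)
      rw [Finset.sum_range_succ, Finset.sum_range_succ]
      have e : ∀ i ∈ Finset.range (k+1), vloc m q p i * (if Even (k + 2 - i) then 1 else 0) =
          vloc m q p i * (if Even (k - i) then 1 else 0) := by
        intro i hi
        have : i ≤ k := by simpa [Nat.lt_succ_iff] using hi
        rw [show k + 2 - i = (k - i) + 2 by omega]
        simp [Nat.even_add]
      rw [Finset.sum_congr rfl e, this]
      simp [vloc]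


theorem vloc_vals_m (m : ℤ) (q p : ℕ) (h : p ∣ m.natAbs) (hp : p.Prime) :
    vloc m q p 1 = -(p:ℝ)^2 / ((p:ℝ)^2 - 1) ∧ vloc m q p 2 = 1 / ((p:ℝ)^2 - 1) ∧
    vloc m q p 3 = (p:ℝ)^2 / ((p:ℝ)^2 - 1) ∧ vloc m q p 4 = -(p:ℝ)^2 / ((p:ℝ)^2 - 1) := by
  have hx : (2:ℝ) ≤ p := by exact_mod_cast hp.two_le
  have : ((p:ℝ)^2 - 1) ≠ 0 := by nlinarith
  refine ⟨?_, ?_, ?_, ?_⟩ <;> simp [vloc, wloc, aloc, h] <;> field_simp <;> ring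

theorem vloc_vals_q (m : ℤ) (q p : ℕ) (h : ¬ p ∣ m.natAbs) (hq : p ∣ q) :
    vloc m q p 1 = 0 ∧ vloc m q p 2 = -1 ∧
    vloc m q p 3 = 0 ∧ vloc m q p 4 = 0 := by
  refine ⟨?_, ?_, ?_, ?_⟩ <;> simp [vloc, wloc, aloc, h, hq]

theorem vloc_vals_g (m : ℤ) (q p : ℕ) (h : ¬ p ∣ m.natAbs) (hq : ¬ p ∣ q) (hp : p.Prime) :
    vloc m q p 1 = 0 ∧ vloc m q p 2 = 2 / ((p:ℝ)^2 - 2) ∧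
    vloc m q p 3 = 0 ∧ vloc m q p 4 = -(p:ℝ)^2 / ((p:ℝ)^2 - 2) := by
  have hx : (2:ℝ) ≤ p := by exact_mod_cast hp.two_le
  have : ((p:ℝ)^2 - 2) ≠ 0 := by nlinarith
  refine ⟨?_, ?_, ?_, ?_⟩ <;> simp [vloc, wloc, aloc, h, hq] <;> field_simp <;> ring

theorem tp_bound (p : ℕ) (hp : p.Prime) : 1 / (p:ℝ)^2 ≤ (p:ℝ) ^ (-(4:ℝ)/3) := by
  have hx : (2:ℝ) ≤ p := by exact_mod_cast hp.two_le
  rw [one_div, ← Real.rpow_natCast, ← Real.rpow_neg (by positivity)]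
  exact Real.rpow_le_rpow_of_exponent_le (by linarith) (by norm_num)

theorem mkf_zero (loc) : mkf loc 0 = 0 := by simp
theorem mkf_one (loc) : mkf loc 1 = 1 := (mkf_mult loc).map_one

theorem summ_a (m : ℤ) (hm : m ≠ 0) (q : ℕ) (hq : 1 ≤ q) : Summable fun n => |mkf (aloc m q) n| := by
  refine (summ_main m hm q hq (fun n => |mkf (aloc m q) n|) (fun n => abs_nonneg _) (by simp) (by simp [mkf_one]) ?_ ?_ ?_).1
  · intro a b hab
    rw [(mkf_mult _).map_mul_of_coprime hab, abs_mul]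
  · intro p hp e he
    rw [mkf_pow _ (aloc_zero m q) hp, aloc_big _ _ _ _ (by omega), abs_zero]
  · intro p hp
    simp only [mkf_pow _ (aloc_zero m q) hp]
    have hx : (2:ℝ) ≤ p := by exact_mod_cast hp.two_le
    have ht := tp_bound p hp
    have ht0 : 0 ≤ (p:ℝ) ^ (-(4:ℝ)/3) := by positivity
    set t := (p:ℝ) ^ (-(4:ℝ)/3)
    by_cases h1 : p ∣ m.natAbs
    · have e1 : 0 < ((p:ℝ)^2 - 1) := by nlinarith
      simp [Finset.sum_range_succ, aloc, h1]
      rw [neg_div, abs_neg, abs_of_nonneg (by positivity : 0 ≤ (p:ℝ) / (p^2-1)), abs_of_pos e1]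
      have : (p:ℝ) / (p^2-1) ≤ 1 := by rw [div_le_one e1]; nlinarith
      have : ((p:ℝ)^2-1)⁻¹ ≤ 1 := by rw [inv_le_one₀ e1]; nlinarith
      split_ifs <;> nlinarith
    · by_cases h2 : p ∣ q
      · simp [Finset.sum_range_succ, aloc, h1, h2]
        nlinarith
      · have e1 : 0 < ((p:ℝ)^2 - 2) := by nlinarith
        simp [Finset.sum_range_succ, aloc, h1, h2]
        rw [abs_of_pos e1]
        have : ((p:ℝ)^2-2)⁻¹ ≤ 2 * (1 / (p:ℝ)^2) := by
          rw [inv_eq_one_div, mul_one_div, div_le_div_iff₀ e1 (by positivity)]; nlinarith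
        linarith

theorem summ_v (m : ℤ) (hm : m ≠ 0) (q : ℕ) (hq : 1 ≤ q) :
    (Summable fun n : ℕ => |mkf (vloc m q) n| * (n:ℝ) ^ (-(1:ℝ)/3)) ∧
    ∑' n : ℕ, |mkf (vloc m q) n| * (n:ℝ) ^ (-(1:ℝ)/3) ≤
      Real.exp rsum * 9 ^ (m.natAbs.primeFactors.card) * 2 ^ (q.primeFactors.card) := by
  refine (summ_main m hm q hq (fun n : ℕ => |mkf (vloc m q) n| * (n:ℝ) ^ (-(1:ℝ)/3)) (fun n => by positivity) (by simp) (by simp [mkf_one]) ?_ ?_ ?_)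
  · intro a b hab
    rw [(mkf_mult _).map_mul_of_coprime hab, abs_mul]
    push_cast
    rw [Real.mul_rpow (by positivity) (by positivity)]
    ring
  · intro p hp e he
    rw [mkf_pow _ (vloc_zero m q) hp, vloc_big _ _ _ _ (by omega), abs_zero, zero_mul]
  · intro p hp
    simp only [mkf_pow _ (vloc_zero m q) hp]
    have hx : (2:ℝ) ≤ p := by exact_mod_cast hp.two_le
    have ht := tp_bound p hp
    have ht0 : 0 ≤ (p:ℝ) ^ (-(4:ℝ)/3) := by positivity
    have hu : ∀ e : ℕ, 0 ≤ ((p^e : ℕ):ℝ) ^ (-(1:ℝ)/3) ∧ ((p^e : ℕ):ℝ) ^ (-(1:ℝ)/3) ≤ 1 := by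
      intro e
      refine ⟨by positivity, Real.rpow_le_one_of_one_le_of_nonpos ?_ (by norm_num)⟩
      exact_mod_cast Nat.one_le_pow _ _ hp.pos
    have hu4 : ((p^4 : ℕ):ℝ) ^ (-(1:ℝ)/3) = (p:ℝ) ^ (-(4:ℝ)/3) := by
      push_cast
      rw [← Real.rpow_natCast, ← Real.rpow_mul (by positivity)]
      norm_num
    set t := (p:ℝ) ^ (-(4:ℝ)/3)
    have k : ∀ e c, |vloc m q p e| ≤ c → |vloc m q p e| * ((p^e : ℕ):ℝ) ^ (-(1:ℝ)/3) ≤ c := by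
      intro e c h
      calc _ ≤ |vloc m q p e| * 1 := by gcongr; exact (hu e).2
        _ ≤ c := by linarith
    have k0 := k 0 1 (by simp [vloc_zero])
    simp only [Finset.sum_range_succ, Finset.sum_range_zero, zero_add]
    by_cases h1 : p ∣ m.natAbs
    · have e1 : 0 < ((p:ℝ)^2 - 1) := by nlinarith
      obtain ⟨v1, v2, v3, v4⟩ := vloc_vals_m m q p h1 hp
      have b : (p:ℝ)^2/(p^2-1) ≤ 2 := by rw [div_le_iff₀ e1]; nlinarith
      have b0 : 0 ≤ (p:ℝ)^2/(p^2-1) := by positivity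
      have c : 1/((p:ℝ)^2-1) ≤ 1 := by rw [div_le_one e1]; nlinarith
      have c0 : 0 ≤ 1/((p:ℝ)^2-1) := by positivity
      have k1 := k 1 2 (by rw [v1, neg_div, abs_neg, abs_of_nonneg b0]; exact b)
      have k2 := k 2 1 (by rw [v2, abs_of_nonneg c0]; exact c)
      have k3 := k 3 2 (by rw [v3, abs_of_nonneg b0]; exact b)
      have k4 := k 4 2 (by rw [v4, neg_div, abs_neg, abs_of_nonneg b0]; exact b)
      rw [if_pos h1]
      have : (9:ℝ) ≤ (1 + 6 * t) * 9 * (if p ∣ q then 2 else 1) := by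
        split_ifs <;> nlinarith
      linarith
    · by_cases h2 : p ∣ q
      · obtain ⟨v1, v2, v3, v4⟩ := vloc_vals_q m q p h1 h2
        have k1 := k 1 0 (by simp [v1])
        have k2 := k 2 1 (by simp [v2])
        have k3 := k 3 0 (by simp [v3])
        have k4 := k 4 0 (by simp [v4])
        rw [if_neg h1, if_pos h2]
        linarith
      · have e1 : 0 < ((p:ℝ)^2 - 2) := by nlinarith
        obtain ⟨v1, v2, v3, v4⟩ := vloc_vals_g m q p h1 h2 hp
        have k1 := k 1 0 (by simp [v1])
        have k3 := k 3 0 (by simp [v3])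
        have k2 := k 2 (4 * (1/(p:ℝ)^2)) (by
          rw [v2, abs_of_nonneg (by positivity), mul_one_div, div_le_div_iff₀ e1 (by positivity)]; nlinarith)
        have k4 : |vloc m q p 4| * ((p^4 : ℕ):ℝ) ^ (-(1:ℝ)/3) ≤ 2 * t := by
          rw [hu4]
          gcongr
          rw [v4, neg_div, abs_neg, abs_of_nonneg (by positivity), div_le_iff₀ e1]; nlinarith
        rw [if_neg h1, if_neg h2]
        linarith


theorem hasProd_fin (n : ℕ) (hn : n ≠ 0) (g : ℕ → ℝ) :
    HasProd (fun p : Nat.Primes => if (p:ℕ) ∣ n then g p else 1) (∏ p ∈ n.primeFactors, g p) := by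
  classical
  set s : Finset Nat.Primes := n.primeFactors.subtype Nat.Prime
  have h : ∏ p ∈ n.primeFactors, g p = ∏ p ∈ s, (if (p:ℕ) ∣ n then g p else 1) := by
    rw [← Finset.prod_subtype_of_mem (p := Nat.Prime) g (fun x hx => Nat.prime_of_mem_primeFactors hx)]
    refine Finset.prod_congr rfl fun p hp => ?_
    have := Nat.dvd_of_mem_primeFactors (Finset.mem_subtype.1 hp)
    exact (if_pos this).symm
  rw [h]
  apply hasProd_prod_of_ne_finset_one
  intro p hp
  rw [if_neg]
  intro hd
  exact hp (Finset.mem_subtype.2 (Nat.mem_primeFactors.2 ⟨p.2, hd, hn⟩))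

theorem mult_help (g : ℕ → ℝ) (C : ℝ) (h : ∀ p : ℕ, p.Prime → |g p - 1| ≤ C / (p:ℝ)^2) :
    Multipliable (fun p : Nat.Primes => g p) := by
  have h1 : Summable (fun p : Nat.Primes => g p - 1) := by
    refine Summable.of_norm_bounded (g := fun p : Nat.Primes => C / ((p:ℕ):ℝ)^2) ?_ (fun p => h p p.2)
    have : Summable (fun n : ℕ => C * (1 / (n:ℝ)^2)) := (Real.summable_one_div_nat_pow.2 (by norm_num)).mul_left C
    have h2 := this.comp_injective (Subtype.val_injective : Function.Injective (fun p : Nat.Primes => (p:ℕ)))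
    refine h2.congr fun p => ?_
    simp [div_eq_mul_inv]
  have := Real.multipliable_one_add_of_summable h1
  simpa using this

noncomputable def cc (m : ℤ) (q : ℕ) : ℝ :=
  (∏' p : Nat.Primes, (1 - 2 / ((p : ℕ) : ℝ) ^ 2)) *
  (∏ p ∈ m.natAbs.primeFactors, (((p : ℝ) ^ 2 - 1) / ((p : ℝ) ^ 2 - 2))) *
  (∏ p ∈ q.primeFactors, (((p : ℝ) ^ 2 - p) / ((p : ℝ) ^ 2 - 2)))

theorem sqfree_fact (m : ℤ) (hm : Squarefree m) (p : ℕ) (hp : p.Prime) (hd : p ∣ m.natAbs) :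
    m.natAbs.factorization p = 1 := by
  have h0 : m.natAbs ≠ 0 := Int.natAbs_ne_zero.2 hm.ne_zero
  have h1 := (Int.squarefree_natAbs.2 hm).natFactorization_le_one p
  have h2 := hp.factorization_pos_of_dvd h0 hd
  omega

theorem aloc_sum_big (m : ℤ) (q p k : ℕ) (hk : 2 ≤ k) :
    ∑ i ∈ Finset.range (k+1), aloc m q p i = 1 + aloc m q p 1 + aloc m q p 2 := by
  have : Finset.range 3 ⊆ Finset.range (k+1) := Finset.range_subset_range.2 (by omega)
  rw [← Finset.sum_subset this]
  · simp [Finset.sum_range_succ, aloc_zero]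
  · intro i _ hi
    exact aloc_big _ _ _ _ (by simpa using hi)

theorem sum_a_ne (m : ℤ) (hm : Squarefree m) (q : ℕ) (l : ℤ) (hl : l ≠ 0) :
    ∑ D ∈ l.natAbs.divisors, mkf (aloc m q) D =
    kappa (Int.gcd l (m ^ 2)) * ∏ p ∈ l.natAbs.primeFactors.filter
        (fun p : ℕ => ((p : ℤ)) ^ 2 ∣ l ∧ ¬ ((p : ℤ)) ∣ m * q),
      (((p : ℝ) ^ 2 - 1) / ((p : ℝ) ^ 2 - 2)) := by
  have hm0 := hm.ne_zero
  set n := l.natAbs with hn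
  have hn0 : n ≠ 0 := Int.natAbs_ne_zero.2 hl
  have hM0 : m.natAbs ≠ 0 := Int.natAbs_ne_zero.2 hm0
  have hg : Int.gcd l (m^2) = Nat.gcd n (m.natAbs^2) := by
    rw [Int.gcd_def, Int.natAbs_pow]
  have h1 : ∑ D ∈ n.divisors, mkf (aloc m q) D =
      ∏ p ∈ n.primeFactors, ∑ i ∈ Finset.range (n.factorization p + 1), aloc m q p i := by
    have hF : ((mkf (aloc m q)) * (ArithmeticFunction.zeta : ArithmeticFunction ℝ)).IsMultiplicative :=
      (mkf_mult _).mul ArithmeticFunction.isMultiplicative_zeta.natCast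
    have := hF.multiplicative_factorization _ hn0
    rw [ArithmeticFunction.coe_mul_zeta_apply] at this
    rw [this, Finsupp.prod, Nat.support_factorization]
    refine Finset.prod_congr rfl fun p hp => ?_
    have hpp := Nat.prime_of_mem_primeFactors hp
    rw [ArithmeticFunction.coe_mul_zeta_apply, Nat.sum_divisors_prime_pow hpp]
    exact Finset.sum_congr rfl fun i _ => mkf_pow _ (aloc_zero m q) hpp i
  have h2 : kappa (Int.gcd l (m^2)) = ∏ p ∈ n.primeFactors, (if p ∣ m.natAbs then
      (if n.factorization p = 1 then ((p : ℝ) ^ 2 - p - 1) / ((p : ℝ) ^ 2 - 1) else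
        ((p : ℝ) ^ 2 - p) / ((p : ℝ) ^ 2 - 1)) else 1) := by
    rw [kappa, hg]
    have hsub : (Nat.gcd n (m.natAbs^2)).primeFactors ⊆ n.primeFactors :=
      Nat.primeFactors_mono (Nat.gcd_dvd_left _ _) hn0
    have hmem : ∀ p, p.Prime → p ∣ n → (p ∈ (Nat.gcd n (m.natAbs^2)).primeFactors ↔ p ∣ m.natAbs) := by
      intro p hp hd
      rw [Nat.mem_primeFactors, Nat.dvd_gcd_iff]
      constructor
      · rintro ⟨_, ⟨_, h⟩, _⟩; exact hp.dvd_of_dvd_pow h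
      · intro h
        exact ⟨hp, ⟨hd, dvd_pow h (by norm_num)⟩, Nat.gcd_ne_zero_left hn0⟩
    rw [← Finset.prod_subset hsub]
    · refine Finset.prod_congr rfl fun p hp => ?_
      have hpp := Nat.prime_of_mem_primeFactors hp
      have hpn := Nat.dvd_of_mem_primeFactors (hsub hp)
      have hpm := (hmem p hpp hpn).1 hp
      rw [if_pos hpm, Nat.factorization_gcd hn0 (pow_ne_zero _ hM0)]
      have e : (n.factorization ⊓ (m.natAbs^2).factorization) p = min (n.factorization p) 2 := by
        rw [Finsupp.inf_apply, Nat.factorization_pow, Finsupp.smul_apply, sqfree_fact m hm p hpp hpm]; rfl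
      rw [e]
      have := hpp.factorization_pos_of_dvd hn0 hpn
      by_cases h : n.factorization p = 1
      · simp [h]
      · have : min (n.factorization p) 2 = 2 := by omega
        simp [this, h]
    · intro p hp hnp
      rw [if_neg]
      intro h
      exact hnp ((hmem p (Nat.prime_of_mem_primeFactors hp) (Nat.dvd_of_mem_primeFactors hp)).2 h)
  rw [h1, h2, Finset.prod_filter, ← Finset.prod_mul_distrib]
  refine Finset.prod_congr rfl fun p hp => ?_
  have hpp := Nat.prime_of_mem_primeFactors hp
  have hpn := Nat.dvd_of_mem_primeFactors hp
  have hv := hpp.factorization_pos_of_dvd hn0 hpn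
  have hx : (2:ℝ) ≤ p := by exact_mod_cast hpp.two_le
  have e1 : ((p:ℝ)^2 - 1) ≠ 0 := by nlinarith
  have e2 : ((p:ℝ)^2 - 2) ≠ 0 := by nlinarith
  have hd1 : (p:ℤ) ∣ m * q ↔ (p ∣ m.natAbs ∨ p ∣ q) := by
    rw [← Int.natCast_dvd_natCast (n := q), ← Int.natCast_dvd, (Nat.prime_iff_prime_int.1 hpp).dvd_mul]
  have hd2 : (p:ℤ)^2 ∣ l ↔ 2 ≤ n.factorization p := by
    rw [← hpp.pow_dvd_iff_le_factorization hn0, hn, ← Int.natCast_dvd]; push_cast; rfl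
  simp only [hd1, hd2]
  by_cases hk : 2 ≤ n.factorization p
  · rw [aloc_sum_big _ _ _ _ hk]
    have : n.factorization p ≠ 1 := by omega
    by_cases a1 : p ∣ m.natAbs
    · simp [aloc, a1, this]; field_simp; ring
    · by_cases a2 : p ∣ q
      · simp [aloc, a1, a2]
      · simp [aloc, a1, a2, hk]; field_simp; ring
  · have : n.factorization p = 1 := by omega
    rw [this]
    by_cases a1 : p ∣ m.natAbs
    · simp [aloc, a1, Finset.sum_range_succ]; field_simp; ring
    · by_cases a2 : p ∣ q
      · simp [aloc, a1, a2, Finset.sum_range_succ]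
      · simp [aloc, a1, a2, Finset.sum_range_succ]

theorem euler5 (loc : ℕ → ℕ → ℝ) (h0 : ∀ p, loc p 0 = 1) (hbig : ∀ p e, 5 ≤ e → loc p e = 0) (s : ℝ)
    (hs : Summable fun n : ℕ => |mkf loc n| * (n:ℝ) ^ s) :
    HasProd (fun p : Nat.Primes => ∑ e ∈ Finset.range 5, loc p e * (((p:ℕ):ℝ) ^ e) ^ s)
      (∑' n : ℕ, mkf loc n * (n:ℝ)^s) := by
  have h := EulerProduct.eulerProduct_hasProd (f := fun n : ℕ => mkf loc n * (n:ℝ)^s) (by simp [mkf_one]) (by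
    intro a b hab
    rw [(mkf_mult _).map_mul_of_coprime hab]
    push_cast
    rw [Real.mul_rpow (by positivity) (by positivity)]
    ring) (by
      refine hs.congr fun n => ?_
      rw [norm_mul, Real.norm_eq_abs, Real.norm_of_nonneg (by positivity)]) (by simp)
  refine Eq.mp (congrArg (fun f => HasProd f _) (funext fun p => ?_)) h
  have : ∀ e, mkf loc (((p:ℕ))^e) * (((p:ℕ)^e : ℕ):ℝ)^s = loc p e * (((p:ℕ):ℝ) ^ e) ^ s := by
    intro e; rw [mkf_pow _ h0 p.2]; push_cast; rfl
  simp only [this]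
  apply tsum_eq_sum
  intro e he
  rw [hbig _ _ (by simpa using he), zero_mul]

theorem sum_a_zero (m : ℤ) (hm : Squarefree m) (q : ℕ) (hq : 1 ≤ q) :
    ∑' D : ℕ, mkf (aloc m q) D =
    kappa (Int.gcd 0 (m ^ 2)) * ∏' p : Nat.Primes,
      (if ((p : ℕ) : ℤ) ∣ m * q then 1
       else ((((p : ℕ) : ℝ)) ^ 2 - 1) / ((((p : ℕ) : ℝ)) ^ 2 - 2)) := by
  have hm0 := hm.ne_zero
  have hM0 : m.natAbs ≠ 0 := Int.natAbs_ne_zero.2 hm0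
  have h := euler5 (aloc m q) (aloc_zero m q) (fun p e he => aloc_big _ _ _ _ (by omega)) 0
    (by simpa using summ_a m hm0 q hq)
  simp only [Real.rpow_zero, mul_one] at h
  have hk : kappa (Int.gcd 0 (m^2)) = ∏ p ∈ m.natAbs.primeFactors, ((p : ℝ) ^ 2 - p) / ((p : ℝ) ^ 2 - 1) := by
    rw [Int.gcd_zero_left, Int.natAbs_pow, kappa, Nat.primeFactors_pow _ (by norm_num)]
    refine Finset.prod_congr rfl fun p hp => ?_
    rw [Nat.factorization_pow, Finsupp.smul_apply, sqfree_fact m hm p (Nat.prime_of_mem_primeFactors hp) (Nat.dvd_of_mem_primeFactors hp)]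
    simp
  have h1 := hasProd_fin m.natAbs hM0 (fun p => ((p : ℝ) ^ 2 - p) / ((p : ℝ) ^ 2 - 1))
  have h2 : Multipliable (fun p : Nat.Primes => (if ((p : ℕ) : ℤ) ∣ m * q then 1
       else ((((p : ℕ) : ℝ)) ^ 2 - 1) / ((((p : ℕ) : ℝ)) ^ 2 - 2))) := by
    refine mult_help (fun p : ℕ => (if ((p : ℕ) : ℤ) ∣ m * q then 1
       else ((((p : ℕ) : ℝ)) ^ 2 - 1) / ((((p : ℕ) : ℝ)) ^ 2 - 2))) 2 ?_
    intro p hp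
    have hx : (2:ℝ) ≤ p := by exact_mod_cast hp.two_le
    have e2 : 0 < ((p:ℝ)^2 - 2) := by nlinarith
    split_ifs
    · simp; positivity
    · have : ((p:ℝ)^2 - 1)/((p:ℝ)^2-2) - 1 = 1/((p:ℝ)^2-2) := by field_simp; ring
      rw [this, abs_of_pos (by positivity), div_le_div_iff₀ e2 (by positivity)]; nlinarith
  rw [hk]
  refine h.unique (Eq.mpr (congrArg (fun f => HasProd f _) (funext fun p => ?_)) (h1.mul h2.hasProd))
  have hpp := p.2
  have hx : (2:ℝ) ≤ ((p:ℕ):ℝ) := by exact_mod_cast hpp.two_le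
  have e1 : (((p:ℕ):ℝ)^2 - 1) ≠ 0 := by nlinarith
  have e2 : (((p:ℕ):ℝ)^2 - 2) ≠ 0 := by nlinarith
  have hd1 : ((p:ℕ):ℤ) ∣ m * q ↔ ((p:ℕ) ∣ m.natAbs ∨ (p:ℕ) ∣ q) := by
    rw [← Int.natCast_dvd_natCast (n := q), ← Int.natCast_dvd, (Nat.prime_iff_prime_int.1 hpp).dvd_mul]
  simp only [hd1]
  by_cases a1 : (p:ℕ) ∣ m.natAbs
  · simp [aloc, a1, Finset.sum_range_succ]; field_simp; ring
  · by_cases a2 : (p:ℕ) ∣ q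
    · simp [aloc, a1, a2, Finset.sum_range_succ]
    · simp [aloc, a1, a2, Finset.sum_range_succ]; field_simp; ring

theorem fq_eq (m : ℤ) (hm : Squarefree m) (q : ℕ) (hq : 1 ≤ q) (l : ℤ) :
    HasSum (fun D : ℕ => mkf (aloc m q) D * (if (D:ℤ) ∣ l then cc m q else 0)) (fq q m l) := by
  by_cases hl : l = 0
  · subst hl
    have h := (summ_a m hm.ne_zero q hq).of_abs.hasSum.mul_right (cc m q)
    rw [sum_a_zero m hm q hq] at h
    simp only [dvd_zero, if_true]
    refine Eq.mp (congrArg (fun z => HasSum _ z) ?_) h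
    rw [fq, if_pos rfl, cc]; ring
  · have h : HasSum (fun D : ℕ => mkf (aloc m q) D * (if (D:ℤ) ∣ l then cc m q else 0))
      (∑ D ∈ l.natAbs.divisors, mkf (aloc m q) D * (if (D:ℤ) ∣ l then cc m q else 0)) := by
      apply hasSum_sum_of_ne_finset_zero
      intro D hD
      rw [if_neg, mul_zero]
      intro hd
      exact hD (Nat.mem_divisors.2 ⟨Int.natCast_dvd.1 hd, Int.natAbs_ne_zero.2 hl⟩)
    refine Eq.mp (congrArg (fun z => HasSum _ z) ?_) h
    have : ∀ D ∈ l.natAbs.divisors, mkf (aloc m q) D * (if (D:ℤ) ∣ l then cc m q else 0) = mkf (aloc m q) D * cc m q := by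
      intro D hD
      rw [if_pos (Int.natCast_dvd.2 (Nat.dvd_of_mem_divisors hD))]
    rw [Finset.sum_congr rfl this, ← Finset.sum_mul, sum_a_ne m hm q l hl, fq, if_neg hl, cc]; ring


noncomputable def bec (m : ℤ) : ℝ := |(m:ℝ)| + |(m:ℝ) - 1| + 1

theorem bec_pos (m : ℤ) : 0 < bec m := by unfold bec; positivity

theorem be_bound (m : ℤ) (y : ℝ) : |be m y| ≤ bec m * |y| := by
  have h1 := bb_le_abs (m * y)
  have h2 := bb_le_abs ((m - 1) * y)
  have h3 := bb_le_abs y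
  have g1 := bb_nonneg (m * y)
  have g2 := bb_nonneg (((m:ℝ) - 1) * y)
  have g3 := bb_nonneg y
  rw [abs_mul] at h1 h2
  unfold be bec
  have := abs_nonneg (m:ℝ)
  have := mul_nonneg (abs_nonneg (m:ℝ)) (abs_nonneg y)
  have := mul_nonneg (abs_nonneg ((m:ℝ)-1)) (abs_nonneg y)
  rw [abs_le]; constructor <;> linarith [abs_nonneg y]

theorem be_zero (m : ℤ) : be m 0 = 0 := by simp [be, bb_zero]

theorem summ_aD (m : ℤ) (hm : m ≠ 0) (q : ℕ) (hq : 1 ≤ q) : Summable fun n : ℕ => mkf (aloc m q) n / n := by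
  refine Summable.of_norm_bounded (summ_a m hm q hq) fun n => ?_
  rw [norm_div, Real.norm_eq_abs, Real.norm_natCast]
  rcases Nat.eq_zero_or_pos n with h | h
  · subst h; simp
  · exact div_le_self (abs_nonneg _) (by exact_mod_cast h)

theorem summ_wbe (m : ℤ) (hm : m ≠ 0) (q : ℕ) (hq : 1 ≤ q) (Y : ℝ) :
    Summable fun D : ℕ => mkf (wloc m q) D * be m (Y / D) := by
  refine Summable.of_norm_bounded ((summ_a m hm q hq).mul_left (bec m * |Y|)) fun n => ?_
  rcases Nat.eq_zero_or_pos n with h | h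
  · subst h; simp
  · have hn : (0:ℝ) < n := by exact_mod_cast h
    have := be_bound m (Y / n)
    rw [wf_eq, norm_mul, norm_mul, Real.norm_eq_abs, Real.norm_eq_abs, Real.norm_eq_abs, abs_of_pos hn]
    rw [abs_div, abs_of_pos hn] at this
    calc n * |mkf (aloc m q) n| * |be m (Y/n)| ≤ n * |mkf (aloc m q) n| * (bec m * (|Y| / n)) := by gcongr
      _ = _ := by field_simp

theorem Acal_eq (m : ℤ) (hm : Squarefree m) (q : ℕ) (hq : 1 ≤ q) (X : ℝ) (hX : 0 < X) :
    Acal m X q = cc m q * (X^2 / q * ∑' D : ℕ, mkf (aloc m q) D / D +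
      q / (2 * m) * ∑' D : ℕ, mkf (wloc m q) D * be m (X / q / D)) := by
  have hm0 := hm.ne_zero
  have hqr : (1:ℝ) ≤ q := by exact_mod_cast hq
  obtain ⟨N, hN⟩ := exists_nat_ge ((|(m:ℝ)| + 1) * X)
  have hN' : (|(m:ℝ)| + 1) * X ≤ N * q := by nlinarith [Nat.cast_nonneg (α := ℝ) N]
  have h1 : Acal m X q = ∑ l ∈ Finset.Icc (-(N:ℤ)) N, fq q m l * Ilen X m q l := by
    apply tsum_eq_sum
    intro l hl
    rw [Ilen_zero X hX m q l N hN', mul_zero]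
    rw [Finset.mem_Icc] at hl
    rw [lt_abs]; omega
  have h2 := hasSum_sum (s := Finset.Icc (-(N:ℤ)) N) (fun l _ => (fq_eq m hm q hq l).mul_right (Ilen X m q l))
  have h3 := (((summ_aD m hm0 q hq).hasSum.mul_left (X^2/q)).add
    ((summ_wbe m hm0 q hq (X / q)).hasSum.mul_left (q / (2 * m : ℝ)))).mul_left (cc m q)
  rw [h1]
  refine h2.unique (Eq.mpr (congrArg (fun f => HasSum f _) (funext fun D => ?_)) h3)
  rcases Nat.eq_zero_or_pos D with h | h
  · subst h; simp
  · have hD : (0:ℝ) < D := by exact_mod_cast h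
    have e := sum_Ilen X hX m hm0 q hq D h N hN'
    have e2 : ∀ l ∈ Finset.Icc (-(N:ℤ)) N, mkf (aloc m q) D * (if (D:ℤ) ∣ l then cc m q else 0) * Ilen X m q l
       = mkf (aloc m q) D * cc m q * (if (D:ℤ) ∣ l then Ilen X m q l else 0) := by
      intro l _; split_ifs <;> ring
    rw [Finset.sum_congr rfl e2, ← Finset.mul_sum, e, wf_eq, div_div]
    have : (m:ℝ) ≠ 0 := by exact_mod_cast hm0
    field_simp

theorem summ_vp (m : ℤ) (hm : m ≠ 0) (q : ℕ) (hq : 1 ≤ q) (s : ℝ) (hs : s ≤ -(1:ℝ)/3) :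
    Summable fun n : ℕ => |mkf (vloc m q) n| * (n:ℝ) ^ s := by
  refine Summable.of_nonneg_of_le (fun n => by positivity) (fun n => ?_) (summ_v m hm q hq).1
  rcases Nat.eq_zero_or_pos n with h | h
  · subst h; simp
  · gcongr
    exact_mod_cast h

theorem summ_sqf : Summable fun S : ℕ => sqf S / (S:ℝ) := by
  have hinj : Function.Injective (fun n : ℕ => n^2) := fun a b h => Nat.pow_left_injective (two_ne_zero) h
  rw [← hinj.summable_iff]
  · refine Summable.of_nonneg_of_le (fun n => ?_) (fun n => ?_) (Real.summable_one_div_nat_pow.2 (by norm_num : 1 < 2))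
    · simp only [Function.comp, sqf_apply]; split_ifs <;> positivity
    · simp only [Function.comp, sqf_apply]; push_cast; gcongr; split_ifs <;> norm_num
  · intro S hS
    rw [sqf_apply, if_neg, zero_div]
    rintro ⟨-, c, hc⟩
    exact hS ⟨c, by simp [hc, sq]⟩

theorem sqf_nonneg (n : ℕ) : 0 ≤ sqf n := by rw [sqf_apply]; split_ifs <;> norm_num

theorem summ_pair (m : ℤ) (hm : m ≠ 0) (q : ℕ) (hq : 1 ≤ q) (Y : ℝ) :
    Summable fun x : ℕ × ℕ => mkf (vloc m q) x.1 * sqf x.2 * be m (Y / (x.1 * x.2)) := by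
  have h1 := (summ_vp m hm q hq (-1) (by norm_num)).mul_of_nonneg summ_sqf (fun n => by positivity)
    (fun n => div_nonneg (sqf_nonneg n) (by positivity))
  refine Summable.of_norm_bounded (h1.mul_left (bec m * |Y|)) fun x => ?_
  have := be_bound m (Y / (x.1 * x.2))
  rw [norm_mul, norm_mul, Real.norm_eq_abs, Real.norm_eq_abs, Real.norm_eq_abs, abs_of_nonneg (sqf_nonneg _)]
  have hs := sqf_nonneg x.2
  calc _ ≤ |mkf (vloc m q) x.1| * sqf x.2 * (bec m * |Y / (x.1 * x.2)|) := by gcongr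
    _ = _ := by
      rw [abs_div, abs_mul, Nat.abs_cast, Nat.abs_cast, Real.rpow_neg_one]
      simp only [div_eq_mul_inv, mul_inv]; ring

theorem regroup (m : ℤ) (hm : m ≠ 0) (q : ℕ) (hq : 1 ≤ q) (Y : ℝ) :
    ∑' D : ℕ, mkf (wloc m q) D * be m (Y / D) =
      ∑' E : ℕ, mkf (vloc m q) E * ∑' n : ℕ, be m (Y / E / (n:ℝ)^2) := by
  have hs := summ_pair m hm q hq Y
  have h1 := (hs.hasSum.tsum_fiberwise (fun x : ℕ × ℕ => x.1 * x.2)).tsum_eq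
  have h2 := hs.tsum_prod
  rw [h2] at h1
  have e1 : ∀ D : ℕ, (∑' b : ((fun x : ℕ × ℕ => x.1 * x.2) ⁻¹' {D}), mkf (vloc m q) (b:ℕ×ℕ).1 * sqf (b:ℕ×ℕ).2 * be m (Y / ((b:ℕ×ℕ).1 * (b:ℕ×ℕ).2)))
      = mkf (wloc m q) D * be m (Y / D) := by
    intro D
    rcases eq_or_ne D 0 with h | h
    · subst h
      rw [mkf_zero, zero_mul]
      refine (tsum_congr fun b => ?_).trans tsum_zero
      have hb : (b:ℕ×ℕ).1 * (b:ℕ×ℕ).2 = 0 := b.2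
      have hb' : (((b:ℕ×ℕ).1 : ℝ) * (b:ℕ×ℕ).2) = 0 := by exact_mod_cast hb
      rw [hb', div_zero, be_zero, mul_zero]
    · have hset : ((fun x : ℕ × ℕ => x.1 * x.2) ⁻¹' {D}) = (Nat.divisorsAntidiagonal D : Set (ℕ × ℕ)) := by
        ext x; simp [h]
      rw [hset, Finset.tsum_subtype' (Nat.divisorsAntidiagonal D) (fun b : ℕ × ℕ => mkf (vloc m q) b.1 * sqf b.2 * be m (Y / (b.1 * b.2))),
        ← vsq, ArithmeticFunction.mul_apply, Finset.sum_mul]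
      refine Finset.sum_congr rfl fun x hx => ?_
      rw [← (Nat.mem_divisorsAntidiagonal.1 hx).1]; push_cast; rfl
  rw [tsum_congr e1] at h1
  rw [h1]
  refine tsum_congr fun E => ?_
  rw [← tsum_mul_left]
  have hinj : Function.Injective (fun n : ℕ => n^2) := fun a b h => Nat.pow_left_injective (two_ne_zero) h
  rw [← hinj.tsum_eq]
  · refine tsum_congr fun n => ?_
    rcases eq_or_ne n 0 with h | h
    · subst h; simp [be_zero]
    · rw [sqf_apply, if_pos ⟨pow_ne_zero _ h, n, sq n⟩, mul_one, div_div]; push_cast; rfl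
  · intro S hS
    by_contra hc
    apply hS
    simp only
    rw [sqf_apply, if_neg, mul_zero, zero_mul]
    rintro ⟨-, c, hc'⟩
    exact hc ⟨c, by simp [hc', sq]⟩

theorem bb_abs (a y : ℝ) : bb (a * y) = bb (|a| * y) := by
  rcases abs_cases a with h | h
  · rw [h.1]
  · rw [h.1, neg_mul, bb_neg]

noncomputable def KK : ℝ := (riemannZeta (3/2)).re / Real.pi

noncomputable def gg (m : ℤ) : ℝ := Real.sqrt |(m:ℝ)| - Real.sqrt |(m:ℝ) - 1| + 1

theorem be_asymp (m : ℤ) : ∃ C > 0, ∀ y ≥ 0,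
    |∑' n : ℕ, be m (y / (n:ℝ)^2) - KK * gg m * Real.sqrt y| ≤ C * y ^ ((1:ℝ)/3) := by
  obtain ⟨C, hC, h⟩ := bb_asymp
  refine ⟨C * (|(m:ℝ)| ^ ((1:ℝ)/3) + |(m:ℝ) - 1| ^ ((1:ℝ)/3) + 1), by positivity, fun y hy => ?_⟩
  have key : ∀ a : ℝ, (Summable fun n : ℕ => bb (a * (y / (n:ℝ)^2))) ∧
      |∑' n : ℕ, bb (a * (y / (n:ℝ)^2)) - KK * (Real.sqrt |a| * Real.sqrt y)| ≤ C * (|a| ^ ((1:ℝ)/3) * y ^ ((1:ℝ)/3)) := by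
    intro a
    have e : (fun n : ℕ => bb (a * (y / (n:ℝ)^2))) = fun n : ℕ => bb ((|a| * y) / (n:ℝ)^2) := by
      funext n; rw [bb_abs, mul_div_assoc]
    rw [e, ← Real.sqrt_mul (abs_nonneg a), ← Real.mul_rpow (abs_nonneg a) hy]
    exact ⟨bb_summable _, h _ (by positivity)⟩
  obtain ⟨s1, k1⟩ := key m
  obtain ⟨s2, k2⟩ := key ((m:ℝ) - 1)
  obtain ⟨s3, k3⟩ := key 1
  simp only [one_mul, abs_one, Real.sqrt_one, Real.one_rpow] at s3 k3
  have : ∑' n : ℕ, be m (y / (n:ℝ)^2) = ∑' n : ℕ, bb (m * (y / (n:ℝ)^2)) -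
    ∑' n : ℕ, bb (((m:ℝ)-1) * (y / (n:ℝ)^2)) + ∑' n : ℕ, bb (y / (n:ℝ)^2) := by
    rw [← s1.tsum_sub s2, ← (s1.sub s2).tsum_add s3]; rfl
  rw [this, gg]
  rw [abs_le] at k1 k2 k3 ⊢
  constructor <;> linarith [k1.1, k1.2, k2.1, k2.2, k3.1, k3.2]

theorem second_asymp (m : ℤ) (hm : m ≠ 0) : ∃ C > 0, ∀ (q : ℕ) (Y : ℝ), 1 ≤ q → 0 < Y →
    |∑' D : ℕ, mkf (wloc m q) D * be m (Y / D) -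
      KK * gg m * Real.sqrt Y * ∑' E : ℕ, mkf (vloc m q) E * (E:ℝ) ^ (-(1:ℝ)/2)| ≤
      C * (q.divisors.card : ℝ) * Y ^ ((1:ℝ)/3) := by
  obtain ⟨C, hC, h⟩ := be_asymp m
  refine ⟨C * (Real.exp rsum * 9 ^ (m.natAbs.primeFactors.card)), by positivity, fun q Y hq hY => ?_⟩
  obtain ⟨hs, hb⟩ := summ_v m hm q hq
  rw [regroup m hm q hq]
  have hs2 : Summable fun E : ℕ => mkf (vloc m q) E * (E:ℝ) ^ (-(1:ℝ)/2) := by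
    refine ((summ_vp m hm q hq (-(1:ℝ)/2) (by norm_num)).of_norm_bounded fun n => ?_)
    rw [norm_mul, Real.norm_eq_abs, Real.norm_of_nonneg (by positivity)]
  set T : ℕ → ℝ := fun E => ∑' n : ℕ, be m (Y / E / (n:ℝ)^2)
  have hd : ∀ E : ℕ, |mkf (vloc m q) E * T E - KK * gg m * Real.sqrt Y * (mkf (vloc m q) E * (E:ℝ) ^ (-(1:ℝ)/2))| ≤
      C * Y ^ ((1:ℝ)/3) * (|mkf (vloc m q) E| * (E:ℝ) ^ (-(1:ℝ)/3)) := by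
    intro E
    rcases Nat.eq_zero_or_pos E with h0 | h0
    · subst h0; simp
    · have hE : (0:ℝ) < E := by exact_mod_cast h0
      have := h (Y / E) (by positivity)
      rw [Real.sqrt_eq_rpow] at this ⊢
      rw [Real.div_rpow hY.le hE.le, Real.div_rpow hY.le hE.le] at this
      have e1 : (E:ℝ) ^ (-(1:ℝ)/2) = ((E:ℝ) ^ ((1:ℝ)/2))⁻¹ := by rw [neg_div, Real.rpow_neg hE.le]
      have e2 : (E:ℝ) ^ (-(1:ℝ)/3) = ((E:ℝ) ^ ((1:ℝ)/3))⁻¹ := by rw [neg_div, Real.rpow_neg hE.le]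
      rw [e1, e2]
      have e3 : mkf (vloc m q) E * T E - KK * gg m * Y ^ ((1:ℝ)/2) * (mkf (vloc m q) E * ((E:ℝ) ^ ((1:ℝ)/2))⁻¹) =
        mkf (vloc m q) E * (T E - KK * gg m * (Y ^ ((1:ℝ)/2) / (E:ℝ) ^ ((1:ℝ)/2))) := by ring
      rw [e3, abs_mul]
      calc _ ≤ |mkf (vloc m q) E| * (C * (Y ^ ((1:ℝ)/3) / (E:ℝ) ^ ((1:ℝ)/3))) := by gcongr
        _ = _ := by ring
  have hs3 := hs.mul_left (C * Y ^ ((1:ℝ)/3))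
  have hs4 : Summable fun E : ℕ => mkf (vloc m q) E * T E - KK * gg m * Real.sqrt Y * (mkf (vloc m q) E * (E:ℝ) ^ (-(1:ℝ)/2)) :=
    Summable.of_norm_bounded hs3 hd
  have hs5 : Summable fun E : ℕ => mkf (vloc m q) E * T E := by
    have := hs4.add (hs2.mul_left (KK * gg m * Real.sqrt Y))
    simpa using this
  rw [← tsum_mul_left, ← hs5.tsum_sub (hs2.mul_left _)]
  have := tsum_of_norm_bounded (f := fun E : ℕ => mkf (vloc m q) E * T E - KK * gg m * Real.sqrt Y * (mkf (vloc m q) E * (E:ℝ) ^ (-(1:ℝ)/2))) hs3.hasSum hd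
  rw [Real.norm_eq_abs] at this
  refine this.trans ?_
  rw [tsum_mul_left]
  have h2 := two_pow_le_divisors q hq
  calc _ ≤ C * Y ^ ((1:ℝ)/3) * (Real.exp rsum * 9 ^ (m.natAbs.primeFactors.card) * 2 ^ (q.primeFactors.card)) := by gcongr
    _ ≤ C * Y ^ ((1:ℝ)/3) * (Real.exp rsum * 9 ^ (m.natAbs.primeFactors.card) * q.divisors.card) := by gcongr
    _ = _ := by ring


theorem hp_zeta2 : HasProd (fun p : Nat.Primes => 1 - (((p:ℕ):ℝ)^2)⁻¹) (6 / Real.pi^2) := by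
  let f : ℕ →*₀ ℝ := ⟨⟨fun n => ((n:ℝ)^2)⁻¹, by simp⟩, by simp, fun a b => by push_cast; rw [mul_pow, mul_inv]⟩
  have hz := hasSum_zeta_two
  have hf : ∀ n, f n = 1 / (n:ℝ)^2 := fun n => (one_div _).symm
  have h := EulerProduct.eulerProduct_completely_multiplicative_hasProd (f := f) (by
    refine hz.summable.congr fun n => ?_
    rw [hf, Real.norm_of_nonneg (by positivity)])
  have e : ∑' n, f n = Real.pi^2/6 := by
    rw [← hz.tsum_eq]; exact tsum_congr hf
  rw [e] at h
  have h2 := h.inv₀ (by positivity)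
  rw [inv_div] at h2
  refine Eq.mp (congrArg (fun f => HasProd f _) (funext fun p => ?_)) h2
  simp [hf]

theorem hp_cc (m : ℤ) (hm : m ≠ 0) (q : ℕ) (hq : 1 ≤ q) :
    HasProd (fun p : Nat.Primes => (1 - 2 / ((p : ℕ) : ℝ) ^ 2) *
      (if (p:ℕ) ∣ m.natAbs then ((((p:ℕ) : ℝ) ^ 2 - 1) / (((p:ℕ) : ℝ) ^ 2 - 2)) else 1) *
      (if (p:ℕ) ∣ q then ((((p:ℕ) : ℝ) ^ 2 - (p:ℕ)) / (((p:ℕ) : ℝ) ^ 2 - 2)) else 1)) (cc m q) := by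
  have h0 : Multipliable (fun p : Nat.Primes => (1 - 2 / ((p : ℕ) : ℝ) ^ 2)) := by
    refine mult_help (fun p : ℕ => 1 - 2 / (p:ℝ)^2) 2 fun p hp => ?_
    rw [show 1 - 2 / (p:ℝ)^2 - 1 = -(2 / (p:ℝ)^2) by ring, abs_neg, abs_of_nonneg (by positivity)]
  exact (h0.hasProd.mul (hasProd_fin m.natAbs (Int.natAbs_ne_zero.2 hm) (fun p : ℕ => (((p : ℝ) ^ 2 - 1) / ((p : ℝ) ^ 2 - 2))))).mul
    (hasProd_fin q (by omega) (fun p : ℕ => (((p : ℝ) ^ 2 - p) / ((p : ℝ) ^ 2 - 2))))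

theorem not_both {m : ℤ} {q p : ℕ} (hp : p.Prime) (hco : Int.gcd m q = 1) (h1 : p ∣ m.natAbs) : ¬ p ∣ q := by
  intro h2
  have : p ∣ Int.gcd m q := by
    rw [Int.gcd_def]; exact Nat.dvd_gcd h1 (by simpa using h2)
  rw [hco] at this
  exact hp.one_lt.ne' (Nat.dvd_one.1 this)

theorem P1 (m : ℤ) (hm : m ≠ 0) (q : ℕ) (hq : 1 ≤ q) (hco : Int.gcd m q = 1) :
    cc m q * ∑' D : ℕ, mkf (aloc m q) D / D = (Nat.totient q : ℝ) / q * (Cq q)^2 := by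
  have hq0 : q ≠ 0 := by omega
  have hqr : (q:ℝ) ≠ 0 := by exact_mod_cast hq0
  have hphi : (Nat.totient q : ℝ) / q = ∏ p ∈ q.primeFactors, (1 - ((p:ℕ):ℝ)⁻¹) := by
    have := congrArg (fun x : ℚ => (x:ℝ)) (Nat.totient_eq_mul_prod_factors q)
    push_cast at this
    rw [this]; field_simp
  have hE := euler5 (aloc m q) (aloc_zero m q) (fun p e he => aloc_big _ _ _ _ (by omega)) (-1) (by
    refine (summ_aD m hm q hq).abs.congr fun n => ?_
    rw [abs_div, Nat.abs_cast, Real.rpow_neg_one]; rfl)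
  have e : ∑' D : ℕ, mkf (aloc m q) D / D = ∑' n : ℕ, mkf (aloc m q) n * (n:ℝ)^(-1:ℝ) :=
    tsum_congr fun n => by rw [Real.rpow_neg_one]; rfl
  rw [e, hphi, Cq, mul_pow, ← Finset.prod_pow]
  have hL := (hp_cc m hm q hq).mul hE
  have hz : HasProd (fun p : Nat.Primes => (1 - (((p:ℕ):ℝ)^2)⁻¹)^2) ((6 / Real.pi^2)^2) := by
    simpa only [sq] using hp_zeta2.mul hp_zeta2
  have hR := (hasProd_fin q hq0 (fun p : ℕ => 1 - ((p:ℕ):ℝ)⁻¹)).mul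
    (hz.mul (hasProd_fin q hq0 (fun p : ℕ => ((1 - ((p : ℝ))⁻¹ ^ 2)⁻¹)^2)))
  refine hL.unique (Eq.mpr (congrArg (fun f => HasProd f _) (funext fun p => ?_)) hR)
  have hx : (2:ℝ) ≤ ((p:ℕ):ℝ) := by exact_mod_cast p.2.two_le
  simp only [Finset.sum_range_succ, Finset.sum_range_zero, Real.rpow_neg_one]
  have nb := not_both (q := q) (m := m) p.2 hco
  have e0 : ((p:ℕ):ℝ) ≠ 0 := by linarith
  have e1 : ((p:ℕ):ℝ)^2 - 1 ≠ 0 := by nlinarith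
  have e2 : ((p:ℕ):ℝ)^2 - 2 ≠ 0 := by nlinarith
  by_cases a1 : (p:ℕ) ∣ m.natAbs
  · simp [aloc, a1, nb a1]; field_simp; ring
  · by_cases a2 : (p:ℕ) ∣ q
    · simp [aloc, a1, a2]; field_simp
    · simp [aloc, a1, a2]; field_simp; ring

theorem P2 (m : ℤ) (hm : m ≠ 0) (q : ℕ) (hq : 1 ≤ q) (hco : Int.gcd m q = 1) :
    cc m q * ∑' E : ℕ, mkf (vloc m q) E * (E:ℝ) ^ (-(1:ℝ)/2) =
      (∏' p : Nat.Primes, ((((p : ℕ) : ℝ) ^ 3 - 3 * ((p : ℕ) : ℝ) + 2) / ((p : ℕ) : ℝ) ^ 3)) *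
      GammaArSF m * (∏ p ∈ q.primeFactors, (1 + 2 * ((p : ℝ))⁻¹)⁻¹) := by
  have hq0 : q ≠ 0 := by omega
  have hE := euler5 (vloc m q) (vloc_zero m q) (fun p e he => vloc_big _ _ _ _ he) (-(1:ℝ)/2)
    (summ_vp m hm q hq _ (by norm_num))
  have hL := (hp_cc m hm q hq).mul hE
  have hz : Multipliable (fun p : Nat.Primes => ((((p : ℕ) : ℝ) ^ 3 - 3 * ((p : ℕ) : ℝ) + 2) / ((p : ℕ) : ℝ) ^ 3)) := by
    refine mult_help (fun p : ℕ => ((p:ℝ)^3 - 3 * p + 2) / (p:ℝ)^3) 3 fun p hp => ?_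
    have hx : (2:ℝ) ≤ (p:ℝ) := by exact_mod_cast hp.two_le
    have : ((p:ℝ)^3 - 3 * p + 2) / (p:ℝ)^3 - 1 = -((3 * p - 2) / (p:ℝ)^3) := by field_simp; ring
    rw [this, abs_neg, abs_of_nonneg (div_nonneg (by linarith) (by positivity)), div_le_div_iff₀ (by positivity) (by positivity)]
    nlinarith [sq_nonneg (p:ℝ)]
  have hR := (hz.hasProd.mul (hasProd_fin m.natAbs (Int.natAbs_ne_zero.2 hm) (fun p : ℕ =>
      (1 + ((p : ℝ) + (p : ℝ) ^ ((1 : ℝ)/2) + 1) /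
      ((p : ℝ) ^ ((3 : ℝ)/2) + (p : ℝ) ^ ((1 : ℝ)/2) + 1))⁻¹))).mul
    (hasProd_fin q hq0 (fun p : ℕ => (1 + 2 * ((p : ℝ))⁻¹)⁻¹))
  refine hL.unique (Eq.mpr (congrArg (fun f => HasProd f _) (funext fun p => ?_)) hR)
  have hx : (2:ℝ) ≤ ((p:ℕ):ℝ) := by exact_mod_cast p.2.two_le
  have nb := not_both (q := q) (m := m) p.2 hco
  set r : ℝ := ((p:ℕ):ℝ) ^ ((1:ℝ)/2) with hr
  have hr0 : 0 < r := by positivity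
  have hp2 : ((p:ℕ):ℝ) = r^2 := by
    rw [hr, ← Real.rpow_natCast, ← Real.rpow_mul (by positivity)]; norm_num
  have hp3 : ((p:ℕ):ℝ) ^ ((3:ℝ)/2) = r^3 := by
    rw [hr, ← Real.rpow_natCast, ← Real.rpow_mul (by positivity)]; norm_num
  have hpe : ∀ e : ℕ, (((p:ℕ):ℝ)^e) ^ (-(1:ℝ)/2) = (r^e)⁻¹ := by
    intro e
    rw [hr, ← Real.rpow_natCast, ← Real.rpow_natCast, ← Real.rpow_mul (by positivity), ← Real.rpow_mul (by positivity),
      ← Real.rpow_neg (by positivity)]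
    congr 1; ring
  simp only [Finset.sum_range_succ, Finset.sum_range_zero, hpe, hp3, vloc_zero]
  have hr2 : 2 ≤ r^2 := by rw [← hp2]; exact hx
  have e1 : (r^2)^2 - 1 ≠ 0 := by nlinarith
  have e2 : (r^2)^2 - 2 ≠ 0 := by nlinarith
  have e1' : r^4 - 1 ≠ 0 := by nlinarith
  have e2' : r^4 - 2 ≠ 0 := by nlinarith
  have e3 : r^3 + r + 1 ≠ 0 := by positivity
  by_cases a1 : (p:ℕ) ∣ m.natAbs
  · obtain ⟨v1, v2, v3, v4⟩ := vloc_vals_m m q p a1 p.2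
    rw [v1, v2, v3, v4, if_pos a1, if_neg (nb a1), if_pos a1, if_neg (nb a1), hp2]
    have e4 : r^3 + r + 1 + (r^2 + r + 1) ≠ 0 := by positivity
    have e5 : 1 + (r^2 + r + 1) / (r^3 + r + 1) = (r^3 + r + 1 + (r^2 + r + 1)) / (r^3 + r + 1) := by field_simp
    rw [e5]
    field_simp
    ring
  · by_cases a2 : (p:ℕ) ∣ q
    · obtain ⟨v1, v2, v3, v4⟩ := vloc_vals_q m q p a1 a2
      rw [v1, v2, v3, v4, if_neg a1, if_pos a2, if_neg a1, if_pos a2, hp2]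
      have e4 : r^2 + 2 ≠ 0 := by positivity
      have e5 : 1 + 2 * (r^2)⁻¹ = (r^2+2)/r^2 := by field_simp
      rw [e5]
      field_simp
      ring
    · obtain ⟨v1, v2, v3, v4⟩ := vloc_vals_g m q p a1 a2 p.2
      rw [v1, v2, v3, v4, if_neg a1, if_neg a2, if_neg a1, if_neg a2, hp2]
      field_simp
      ring

theorem cc_bound (m : ℤ) : ∃ B > 0, ∀ q : ℕ, |cc m q| ≤ B := by
  refine ⟨|(∏' p : Nat.Primes, (1 - 2 / ((p : ℕ) : ℝ) ^ 2)) *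
  (∏ p ∈ m.natAbs.primeFactors, (((p : ℝ) ^ 2 - 1) / ((p : ℝ) ^ 2 - 2)))| + 1, by positivity, fun q => ?_⟩
  rw [cc, abs_mul]
  have h1 : |∏ p ∈ q.primeFactors, (((p : ℝ) ^ 2 - p) / ((p : ℝ) ^ 2 - 2))| ≤ 1 := by
    rw [Finset.abs_prod]
    refine Finset.prod_le_one (fun _ _ => abs_nonneg _) fun p hp => ?_
    have hx : (2:ℝ) ≤ (p:ℝ) := by exact_mod_cast (Nat.prime_of_mem_primeFactors hp).two_le
    have e2 : 0 < (p:ℝ)^2 - 2 := by nlinarith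
    rw [abs_of_nonneg (div_nonneg (by nlinarith) e2.le), div_le_one e2]
    linarith
  nlinarith [abs_nonneg ((∏' p : Nat.Primes, (1 - 2 / ((p : ℕ) : ℝ) ^ 2)) *
  (∏ p ∈ m.natAbs.primeFactors, (((p : ℝ) ^ 2 - 1) / ((p : ℝ) ^ 2 - 2))))]

theorem gg_eq (m : ℤ) (hm : m ≠ 0) : gg m / m = GammaAn m := by
  unfold gg GammaAn
  split_ifs with h
  · have h1 : (1:ℝ) ≤ m := by exact_mod_cast h
    rw [abs_of_nonneg (by linarith), abs_of_nonneg (by linarith)]; ring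
  · have h1 : (m:ℝ) ≤ 0 := by exact_mod_cast (not_lt.1 h)
    have h2 : (m:ℝ) ≠ 0 := by exact_mod_cast hm
    rw [abs_of_nonpos h1, abs_of_nonpos (by linarith), neg_sub]
    field_simp; ring

theorem statement13 (m : ℤ) (hm : Squarefree m) :
    ∃ A : ℝ, 0 < A ∧ ∀ (X : ℝ) (q : ℕ), 1 < X → 1 ≤ q → Int.gcd m q = 1 →
      |Acal m X q - ((Nat.totient q : ℝ) * (Cq q * X / q) ^ 2
          + Cmain / 2 * GammaAn m * GammaArSF m *
              (∏ p ∈ q.primeFactors, (1 + 2 * ((p : ℝ))⁻¹)⁻¹) *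
              X ^ ((1 : ℝ)/2) * (q : ℝ) ^ ((1 : ℝ)/2))|
        ≤ A * (q.divisors.card : ℝ) * X ^ ((1 : ℝ)/3) * (q : ℝ) ^ ((2 : ℝ)/3) := by
  have hm0 := hm.ne_zero
  have hmr : (m:ℝ) ≠ 0 := by exact_mod_cast hm0
  have hma : 0 < |(m:ℝ)| := abs_pos.2 hmr
  obtain ⟨C, hC, h⟩ := second_asymp m hm0
  obtain ⟨B, hB, hb⟩ := cc_bound m
  refine ⟨B * C / (2 * |(m:ℝ)|), by positivity, fun X q hX hq hco => ?_⟩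
  have hX0 : 0 < X := by linarith
  have hq0 : (0:ℝ) < q := by exact_mod_cast hq
  have h1 := h q (X / q) hq (by positivity)
  rw [Acal_eq m hm q hq X hX0]
  have p1 := P1 m hm0 q hq hco
  have p2 := P2 m hm0 q hq hco
  set S1 := ∑' D : ℕ, mkf (aloc m q) D / D
  set S2 := ∑' D : ℕ, mkf (wloc m q) D * be m (X / q / D)
  set S3 := ∑' E : ℕ, mkf (vloc m q) E * (E:ℝ) ^ (-(1:ℝ)/2)
  have hhalf : X ^ ((1 : ℝ)/2) * (q : ℝ) ^ ((1 : ℝ)/2) = q * Real.sqrt (X / q) := by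
    rw [← Real.sqrt_eq_rpow, ← Real.sqrt_eq_rpow, Real.sqrt_div hX0.le]
    have := Real.mul_self_sqrt hq0.le
    have h3 := Real.sqrt_pos.2 hq0
    field_simp
    nlinarith
  have hthird : X ^ ((1 : ℝ)/3) * (q : ℝ) ^ ((2 : ℝ)/3) = q * (X / q) ^ ((1:ℝ)/3) := by
    rw [Real.div_rpow hX0.le hq0.le, show (2:ℝ)/3 = 1 - 1/3 by norm_num, Real.rpow_sub hq0, Real.rpow_one]
    ring
  have main2 : Cmain / 2 * GammaAn m * GammaArSF m *
              (∏ p ∈ q.primeFactors, (1 + 2 * ((p : ℝ))⁻¹)⁻¹) *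
              X ^ ((1 : ℝ)/2) * (q : ℝ) ^ ((1 : ℝ)/2) =
      cc m q * (q / (2 * m)) * (KK * gg m * Real.sqrt (X / q) * S3) := by
    rw [mul_assoc _ (X ^ ((1 : ℝ)/2)), hhalf, ← gg_eq m hm0, Cmain]
    change KK * _ / 2 * _ * _ * _ * _ = _
    calc _ = KK / 2 * (gg m / m) * ((∏' p : Nat.Primes, ((((p : ℕ) : ℝ) ^ 3 - 3 * ((p : ℕ) : ℝ) + 2) / ((p : ℕ) : ℝ) ^ 3)) *
      GammaArSF m * (∏ p ∈ q.primeFactors, (1 + 2 * ((p : ℝ))⁻¹)⁻¹)) * (q * Real.sqrt (X / q)) := by ring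
      _ = _ := by rw [← p2]; field_simp
  have main1 : (Nat.totient q : ℝ) * (Cq q * X / q) ^ 2 = cc m q * (X^2 / q * S1) := by
    calc _ = (Nat.totient q : ℝ) / q * (Cq q)^2 * (X^2 / q) := by field_simp
      _ = _ := by rw [← p1]; ring
  rw [main1, main2]
  have e : cc m q * (X^2 / q * S1 + q / (2 * m) * S2) - (cc m q * (X^2 / q * S1) + cc m q * (q / (2 * m)) * (KK * gg m * Real.sqrt (X / q) * S3))
    = cc m q * (q / (2 * m)) * (S2 - KK * gg m * Real.sqrt (X / q) * S3) := by ring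
  rw [e, abs_mul, abs_mul, abs_div, abs_mul, abs_two, abs_of_pos hq0]
  calc _ ≤ B * (q / (2 * |(m:ℝ)|)) * (C * (q.divisors.card : ℝ) * (X / q) ^ ((1:ℝ)/3)) := by
        gcongr; exact hb q
    _ = B * C / (2 * |(m:ℝ)|) * q.divisors.card * (q * (X / q) ^ ((1:ℝ)/3)) := by ring
    _ = _ := by rw [← hthird]; ring
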